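/- arXiv:1407.2496 — 2 statements merged into one kernel-verified Lean document; each statement's English description precedes it below -/
import Mathlib

section
/- Let G = Gal(𝒞_K(p)/K). For every ν > 0, G^ν = ⋂ Gal(𝒞_K(p)/L), where the intersection is taken over all intermediate fields L with K ⊆ L ⊆ 𝒞_K(p), [L : K] = p, and v_L(𝒟_{L/K})/(p−1) < ν + 1. -/
noncomputable section

open scoped Classical

namespace PaperRam

/-- An additive `ℤ ∪ {∞}`-valued valuation on a field is *normalized* if it is
surjective onto `ℤ`. -/
def IsNormalized {F : Type*} [Field F] (v : AddValuation F (WithTop ℤ)) : Prop :=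
  ∀ n : ℤ, ∃ x : F, v x = (n : WithTop ℤ)

/-- The normalized valuation `vF` of `F` extends the normalized valuation `vK` of `K`
with ramification index `e`, i.e. `vF(x) = e · vK(x)` for all `x ∈ K`. -/
def Extends {K F : Type*} [Field K] [Field F] [Algebra K F]
    (vK : AddValuation K (WithTop ℤ)) (vF : AddValuation F (WithTop ℤ)) (e : ℕ) : Prop :=
  0 < e ∧ ∀ x : K, vF (algebraMap K F x) = e • vK x

/-- `v` is the normalized valuation of the `p`-adic field `K`, with (absolute)
ramification index `eK` over `ℚ_p`. -/
def IsPadicValuation (p : ℕ) [Fact p.Prime] {K : Type*} [Field K] [Algebra ℚ_[p] K]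
    (v : AddValuation K (WithTop ℤ)) (eK : ℕ) : Prop :=
  IsNormalized v ∧ 0 < eK ∧
    ∀ x : ℚ_[p], x ≠ 0 → v (algebraMap ℚ_[p] K x) = ((eK * x.valuation : ℤ) : WithTop ℤ)

/-- The valuation `v` of `F` is invariant under all `K`-algebra automorphisms of `F`. -/
def GalInvariant (K : Type*) {F : Type*} [Field K] [Field F] [Algebra K F]
    (v : AddValuation F (WithTop ℤ)) : Prop :=
  ∀ (σ : F ≃ₐ[K] F) (x : F), v (σ x) = v x

variable {K F : Type*} [Field K] [Field F] [Algebra K F]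

/-- The lower-numbering ramification subgroup `G_i` of `Gal(F/K)`:
`σ ∈ G_i ↔ v(σ x − x) ≥ i + 1` for all `x` in the valuation ring of `F`. -/
def lowerRG (v : AddValuation F (WithTop ℤ)) (hv : GalInvariant K v) (i : ℤ) :
    Subgroup (F ≃ₐ[K] F) where
  carrier := {σ | ∀ x : F, 0 ≤ v x → ((i + 1 : ℤ) : WithTop ℤ) ≤ v (σ x - x)}
  one_mem' := by
    intro x _
    simp
  mul_mem' := by
    intro a b ha hb x hx
    have h1 : ((i + 1 : ℤ) : WithTop ℤ) ≤ v (a (b x) - b x) :=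
      ha (b x) (by rw [hv b x]; exact hx)
    have h2 := hb x hx
    have hrw : (a * b) x - x = (a (b x) - b x) + (b x - x) := by
      rw [AlgEquiv.mul_apply]; ring
    rw [hrw]
    exact v.map_le_add h1 h2
  inv_mem' := by
    intro a ha x hx
    have hda : a (a⁻¹ x - x) = x - a x := by
      rw [map_sub]
      congr 1
      exact a.apply_symm_apply x
    have : v (a⁻¹ x - x) = v (a x - x) := by
      rw [← hv a (a⁻¹ x - x), hda, v.map_sub_swap]
    rw [this]
    exact ha x hx

/-- The Herbrand function `φ_{F/K}` evaluated at integers. -/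
def herbrandPhi (v : AddValuation F (WithTop ℤ)) (hv : GalInvariant K v) (n : ℤ) : ℚ :=
  if n ≤ 0 then (n : ℚ)
  else (∑ i ∈ Finset.Icc (1 : ℤ) n, (Nat.card (lowerRG v hv i) : ℚ)) /
    (Nat.card (lowerRG v hv 0) : ℚ)

/-- The upper-numbering ramification subgroup `G^u = G_{ψ(u)}` of `Gal(F/K)`. -/
def upperRG (v : AddValuation F (WithTop ℤ)) (hv : GalInvariant K v) (u : ℤ) :
    Subgroup (F ≃ₐ[K] F) :=
  lowerRG v hv (sInf {n : ℤ | (u : ℚ) ≤ herbrandPhi v hv n})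

/-- `t` is an upper ramification jump of `F/K`: `G^u ≠ G^t` for every `u > t`. -/
def IsUpperJump (v : AddValuation F (WithTop ℤ)) (hv : GalInvariant K v) (t : ℤ) : Prop :=
  ∀ u : ℤ, t < u → upperRG v hv u ≠ upperRG v hv t

/-- A group is elementary abelian of exponent `p` if it is isomorphic to `(ℤ/pℤ)^k`
for some `k`. -/
def IsElemAbelian (p : ℕ) (G : Type*) [Group G] : Prop :=
  ∃ k : ℕ, Nonempty (G ≃* (Fin k → Multiplicative (ZMod p)))

/-- The norm group `N_{L/K}(L^×)`, as a subgroup of `K^×`. -/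
def normGroup (K L : Type*) [Field K] [Field L] [Algebra K L] : Subgroup Kˣ :=
  (Units.map (Algebra.norm K : L →* K)).range

/-- The residues of `c 0, …, c (f-1)` lie in the valuation ring and form a basis of
the residue field of `v` over `𝔽_p`. -/
def IsResidueBasis (p : ℕ) {K : Type*} [Field K] (v : AddValuation K (WithTop ℤ))
    {f : ℕ} (c : Fin f → K) : Prop :=
  (∀ y, 0 ≤ v (c y)) ∧
  (∀ a : Fin f → ℤ, (1 : WithTop ℤ) ≤ v (∑ y, (a y : K) * c y) → ∀ y, (p : ℤ) ∣ a y) ∧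
  (∀ x : K, 0 ≤ v x → ∃ a : Fin f → ℤ, (1 : WithTop ℤ) ≤ v (x - ∑ y, (a y : K) * c y))

/-- `v_L(𝒟_{L/K})`: the valuation of the different of `L/K`, defined through the
inverse different `{x ∈ L ∣ Tr_{L/K}(x·𝒪_L) ⊆ 𝒪_K} = 𝔪_L^{-d}`. -/
def differentVal (K : Type*) {L : Type*} [Field K] [Field L] [Algebra K L]
    (vK : AddValuation K (WithTop ℤ)) (vL : AddValuation L (WithTop ℤ)) : ℤ :=
  sSup {m : ℤ | ∃ x : L, vL x = ((-m : ℤ) : WithTop ℤ) ∧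
    ∀ y : L, 0 ≤ vL y → 0 ≤ vK (Algebra.trace K L (x * y))}

/-- The maximal elementary abelian `p`-extension `𝒞_K(p)` of `K` inside `Ω`: the
compositum of all cyclic (equivalently, normal) extensions of `K` of degree `p`. -/
def maxElemAbelian (p : ℕ) (K Ω : Type*) [Field K] [Field Ω] [Algebra K Ω] :
    IntermediateField K Ω :=
  ⨆ L ∈ {L : IntermediateField K Ω | Module.finrank K L = p ∧ Normal K L}, L

/-- The subgroup `U_K^{i+1} = 1 + 𝔪_K^{i+1}` of principal units of `K^×`
(the index is shifted by one so that `principalUnits v 0 = U_K^1`). -/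
def principalUnits {K : Type*} [Field K] (v : AddValuation K (WithTop ℤ)) (i : ℕ) :
    Subgroup Kˣ where
  carrier := {x : Kˣ | (((i : ℤ) + 1 : ℤ) : WithTop ℤ) ≤ v ((x : K) - 1)}
  one_mem' := by simp
  mul_mem' := by
    intro a b ha hb
    have hpos : (0 : WithTop ℤ) < (((i : ℤ) + 1 : ℤ) : WithTop ℤ) := by
      rw [show (0 : WithTop ℤ) = ((0 : ℤ) : WithTop ℤ) from rfl]
      exact WithTop.coe_lt_coe.mpr (by omega)
    have hva : v (a : K) = 0 := by
      have h1 : v ((1 : K)) < v ((a : K) - 1) := by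
        rw [v.map_one]; exact lt_of_lt_of_le hpos ha
      have h2 := v.map_add_eq_of_lt_right h1
      rw [sub_add_cancel] at h2
      rw [h2, v.map_one]
    have key : ((a * b : Kˣ) : K) - 1 = (a : K) * ((b : K) - 1) + ((a : K) - 1) := by
      push_cast; ring
    show (((i : ℤ) + 1 : ℤ) : WithTop ℤ) ≤ v (((a * b : Kˣ) : K) - 1)
    rw [key]
    refine v.map_le_add ?_ ha
    rw [v.map_mul, hva, zero_add]
    exact hb
  inv_mem' := by
    intro a ha
    have hpos : (0 : WithTop ℤ) < (((i : ℤ) + 1 : ℤ) : WithTop ℤ) := by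
      rw [show (0 : WithTop ℤ) = ((0 : ℤ) : WithTop ℤ) from rfl]
      exact WithTop.coe_lt_coe.mpr (by omega)
    have hva : v (a : K) = 0 := by
      have h1 : v ((1 : K)) < v ((a : K) - 1) := by
        rw [v.map_one]; exact lt_of_lt_of_le hpos ha
      have h2 := v.map_add_eq_of_lt_right h1
      rw [sub_add_cancel] at h2
      rw [h2, v.map_one]
    have key : ((a⁻¹ : Kˣ) : K) - 1 = ((a : K))⁻¹ * (1 - (a : K)) := by
      rw [mul_sub, mul_one, inv_mul_cancel₀ (Units.ne_zero a)]
      push_cast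
      ring
    show (((i : ℤ) + 1 : ℤ) : WithTop ℤ) ≤ v (((a⁻¹ : Kˣ) : K) - 1)
    rw [key, v.map_mul, v.map_inv, hva, v.map_sub_swap]
    simpa using ha

/-- The valuation ring of an additive valuation. -/
abbrev valRing {E : Type*} [Field E] (v : AddValuation E (WithTop ℤ)) : ValuationSubring E :=
  (AddValuation.toValuation v).valuationSubring

section ValRing

variable {E : Type*} [Field E] {v : AddValuation E (WithTop ℤ)}

lemma mem_valRing {x : E} : x ∈ valRing v ↔ 0 ≤ v x := Iff.rfl

lemma exists_val_eq {x : E} (hx : x ≠ 0) : ∃ n : ℤ, v x = (n : WithTop ℤ) := by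
  obtain ⟨n, hn⟩ := WithTop.ne_top_iff_exists.mp ((AddValuation.ne_top_iff v).mpr hx)
  exact ⟨n, hn.symm⟩

lemma ne_zero_of_val_eq {x : E} {n : ℤ} (h : v x = (n : WithTop ℤ)) : x ≠ 0 := by
  rintro rfl
  simp at h

lemma val_inv_eq {x : E} {n : ℤ} (h : v x = (n : WithTop ℤ)) :
    v x⁻¹ = ((-n : ℤ) : WithTop ℤ) := by
  have h0 := ne_zero_of_val_eq h
  obtain ⟨m, hm⟩ := exists_val_eq (v := v) (inv_ne_zero h0)
  have h1 : v (x * x⁻¹) = 0 := by rw [mul_inv_cancel₀ h0, v.map_one]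
  rw [v.map_mul, h, hm] at h1
  rw [hm]
  norm_cast at h1 ⊢
  omega

lemma val_mul_eq {x y : E} {n m : ℤ} (hx : v x = (n : WithTop ℤ)) (hy : v y = (m : WithTop ℤ)) :
    v (x * y) = ((n + m : ℤ) : WithTop ℤ) := by
  rw [v.map_mul, hx, hy]; norm_cast

lemma val_pow_eq {x : E} {n : ℤ} (hx : v x = (n : WithTop ℤ)) (k : ℕ) :
    v (x ^ k) = ((k * n : ℤ) : WithTop ℤ) := by
  induction k with
  | zero => simp
  | succ k ih => rw [pow_succ, val_mul_eq ih hx]; congr 1; push_cast; ring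

lemma val_zpow_eq {x : E} {n : ℤ} (hx : v x = (n : WithTop ℤ)) (k : ℤ) :
    v (x ^ k) = ((k * n : ℤ) : WithTop ℤ) := by
  obtain ⟨k, rfl | rfl⟩ := k.eq_nat_or_neg
  · rw [zpow_natCast, val_pow_eq hx]
  · rw [zpow_neg, zpow_natCast, val_inv_eq (val_pow_eq hx k)]; congr 1; ring

lemma isUnit_valRing_iff {x : valRing v} : IsUnit x ↔ v (x : E) = 0 := by
  constructor
  · rintro ⟨u, rfl⟩
    have h1 : v ((u : valRing v) : E) + v (((u⁻¹ : (valRing v)ˣ) : valRing v) : E) = 0 := by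
      rw [← v.map_mul, ← MulMemClass.coe_mul, ← Units.val_mul, mul_inv_cancel]
      simp
    have h2 : 0 ≤ v ((u : valRing v) : E) := u.1.2
    have h3 : 0 ≤ v (((u⁻¹ : (valRing v)ˣ) : valRing v) : E) := (u⁻¹).1.2
    refine le_antisymm ?_ h2
    calc v ((u : valRing v) : E) ≤ v ((u : valRing v) : E) +
          v (((u⁻¹ : (valRing v)ˣ) : valRing v) : E) := le_add_of_nonneg_right h3
      _ = 0 := h1
  · intro h
    have h' : v (x : E) = ((0 : ℤ) : WithTop ℤ) := by simpa using h
    have h0 := ne_zero_of_val_eq h'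
    refine IsUnit.of_mul_eq_one ⟨(x : E)⁻¹, ?_⟩ (Subtype.ext ?_)
    · rw [mem_valRing, val_inv_eq h']; simp
    · simp [h0]

lemma one_le_val_iff_pos {x : E} : 1 ≤ v x ↔ 0 < v x := by
  by_cases h : x = 0
  · simp [h]
  · obtain ⟨n, hn⟩ := exists_val_eq (v := v) h
    rw [hn]; norm_cast

lemma mem_maximalIdeal_valRing {x : valRing v} :
    x ∈ IsLocalRing.maximalIdeal (valRing v) ↔ 1 ≤ v (x : E) := by
  rw [IsLocalRing.mem_maximalIdeal, mem_nonunits_iff, isUnit_valRing_iff, one_le_val_iff_pos]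
  have : 0 ≤ v (x : E) := x.2
  rw [lt_iff_le_and_ne]
  exact ⟨fun h => ⟨this, Ne.symm h⟩, fun h => h.2.symm⟩

lemma dvd_valRing_iff {x y : valRing v} : x ∣ y ↔ v (x : E) ≤ v (y : E) := by
  constructor
  · rintro ⟨z, rfl⟩
    rw [MulMemClass.coe_mul, v.map_mul]
    exact le_add_of_nonneg_right z.2
  · intro h
    by_cases hx : (x : E) = 0
    · rw [hx, v.map_zero, top_le_iff, AddValuation.top_iff] at h
      have : y = 0 := Subtype.ext h
      rw [this]; exact dvd_zero x
    · by_cases hy : (y : E) = 0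
      · have : y = 0 := Subtype.ext hy
        rw [this]; exact dvd_zero x
      obtain ⟨n, hn⟩ := exists_val_eq (v := v) hx
      obtain ⟨m, hm⟩ := exists_val_eq (v := v) hy
      refine ⟨⟨(y : E) * (x : E)⁻¹, ?_⟩, Subtype.ext ?_⟩
      · rw [mem_valRing, val_mul_eq hm (val_inv_eq hn)]
        rw [hn, hm] at h
        norm_cast at h ⊢
        omega
      · push_cast
        field_simp

lemma isDiscreteValuationRing_valRing (hv : IsNormalized v) :
    IsDiscreteValuationRing (valRing v) := by
  obtain ⟨ϖ, hϖ⟩ := hv 1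
  have hmem : ϖ ∈ valRing v := by rw [mem_valRing, hϖ]; norm_cast
  apply IsDiscreteValuationRing.ofHasUnitMulPowIrreducibleFactorization
  refine ⟨⟨ϖ, hmem⟩, ⟨?_, ?_⟩, ?_⟩
  · rw [isUnit_valRing_iff, hϖ]; norm_cast
  · intro a b hab
    rw [isUnit_valRing_iff, isUnit_valRing_iff]
    have h : ϖ = a * b := congrArg Subtype.val hab
    have hϖ0 := ne_zero_of_val_eq hϖ
    obtain ⟨n, hn⟩ := exists_val_eq (v := v) (x := (a : E)) (by rintro h'; simp [h', hϖ0] at h)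
    obtain ⟨m, hm⟩ := exists_val_eq (v := v) (x := (b : E)) (by rintro h'; simp [h', hϖ0] at h)
    have ha : 0 ≤ v (a : E) := a.2
    have hb : 0 ≤ v (b : E) := b.2
    rw [h, val_mul_eq hn hm] at hϖ
    rw [hn] at ha ⊢
    rw [hm] at hb ⊢
    norm_cast at *
    omega
  · intro x hx
    have hx' : (x : E) ≠ 0 := fun h => hx (Subtype.ext h)
    obtain ⟨n, hn⟩ := exists_val_eq (v := v) hx'
    have hx0 : 0 ≤ v (x : E) := x.2
    rw [hn] at hx0
    have hn0 : 0 ≤ n := by exact_mod_cast hx0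
    refine ⟨n.toNat, ?_⟩
    have hval : v ((⟨ϖ, hmem⟩ ^ n.toNat : valRing v) : E) = (n : WithTop ℤ) := by
      rw [SubmonoidClass.coe_pow, val_pow_eq hϖ]
      congr 1
      simp [hn0]
    apply associated_of_dvd_dvd
    · rw [dvd_valRing_iff, hval, hn]
    · rw [dvd_valRing_iff, hval, hn]

lemma mem_maximalIdeal_pow_valRing (hv : IsNormalized v) {x : valRing v} {n : ℕ} :
    x ∈ IsLocalRing.maximalIdeal (valRing v) ^ n ↔ ((n : ℤ) : WithTop ℤ) ≤ v (x : E) := by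
  obtain ⟨ϖ, hϖ⟩ := hv 1
  have hmem : ϖ ∈ valRing v := by rw [mem_valRing, hϖ]; norm_cast
  have hspan : IsLocalRing.maximalIdeal (valRing v) = Ideal.span {⟨ϖ, hmem⟩} := by
    ext y
    rw [mem_maximalIdeal_valRing, Ideal.mem_span_singleton, dvd_valRing_iff, hϖ]
    norm_cast
  rw [hspan, Ideal.span_singleton_pow, Ideal.mem_span_singleton, dvd_valRing_iff,
    SubmonoidClass.coe_pow, val_pow_eq hϖ, mul_one]

end ValRing

section GaloisExtension

variable {F E : Type*} [Field F] [Field E] [Algebra F E]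
  {vF : AddValuation F (WithTop ℤ)} {vE : AddValuation E (WithTop ℤ)} {e : ℕ}

lemma Extends.nonneg_iff (h : Extends vF vE e) {x : F} :
    0 ≤ vE (algebraMap F E x) ↔ 0 ≤ vF x := by
  by_cases hx : x = 0
  · simp [hx]
  · obtain ⟨n, hn⟩ := exists_val_eq (v := vF) hx
    rw [h.2, hn, ← WithTop.coe_nsmul]
    have := h.1
    norm_cast
    simp only [nsmul_eq_mul]
    constructor
    · intro h'; by_contra hc; push Not at hc
      have : (e : ℤ) * n < 0 := by apply mul_neg_of_pos_of_neg <;> omega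
      omega
    · intro h'; positivity

lemma Extends.val_eq (h : Extends vF vE e) {x : F} {n : ℤ} (hx : vF x = (n : WithTop ℤ)) :
    vE (algebraMap F E x) = ((e * n : ℤ) : WithTop ℤ) := by
  rw [h.2, hx, ← WithTop.coe_nsmul, nsmul_eq_mul]

/-- The Galois action on the valuation ring of an invariant valuation. -/
abbrev valRingAction (hG : GalInvariant F vE) : MulSemiringAction (E ≃ₐ[F] E) (valRing vE) where
  smul σ x := ⟨σ x, by rw [mem_valRing, hG]; exact x.2⟩
  one_smul _ := rfl
  mul_smul _ _ _ := rfl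
  smul_zero σ := Subtype.ext (map_zero σ)
  smul_add σ x y := Subtype.ext (map_add σ (x : E) y)
  smul_one σ := Subtype.ext (map_one σ)
  smul_mul σ x y := Subtype.ext (map_mul σ (x : E) y)

/-- The inclusion of valuation rings coming from an extension of valuations. -/
abbrev valRingAlgebra (h : Extends vF vE e) : Algebra (valRing vF) (valRing vE) :=
  (((algebraMap F E).comp (algebraMap (valRing vF) F)).codRestrict (valRing vE)
    (fun x => h.nonneg_iff.mpr x.2)).toAlgebra

lemma isGaloisGroup_valRing [FiniteDimensional F E] [IsGalois F E]
    (h : Extends vF vE e) (hG : GalInvariant F vE) :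
    let _ := valRingAction hG
    let _ := valRingAlgebra h
    IsGaloisGroup (E ≃ₐ[F] E) (valRing vF) (valRing vE) := by
  let _ := valRingAction hG
  let _ := valRingAlgebra h
  refine ⟨⟨?_⟩, ⟨?_⟩, ⟨?_⟩⟩
  · intro σ τ hστ
    ext x
    obtain ⟨a, b, hb, rfl⟩ := IsFractionRing.div_surjective (A := valRing vE) x
    have ha := congrArg Subtype.val (hστ a)
    have hb := congrArg Subtype.val (hστ b)
    change σ (a : E) = τ (a : E) at ha
    change σ (b : E) = τ (b : E) at hb
    change σ ((a : E) / b) = τ ((a : E) / b)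
    rw [map_div₀, map_div₀, ha, hb]
  · intro σ a x
    apply Subtype.ext
    change σ (algebraMap F E a * x) = algebraMap F E a * σ x
    rw [map_mul, AlgEquiv.commutes]
  · intro b hb
    have : (b : E) ∈ Set.range (algebraMap F E) := by
      rw [IsGalois.mem_range_algebraMap_iff_fixed]
      intro σ
      exact congrArg Subtype.val (hb σ)
    obtain ⟨a, ha⟩ := this
    refine ⟨⟨a, ?_⟩, Subtype.ext ha⟩
    rw [mem_valRing, ← h.nonneg_iff, ha]
    exact b.2

lemma isIntegral_valRing_iff [FiniteDimensional F E] [IsGalois F E]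
    (h : Extends vF vE e) (hG : GalInvariant F vE) {x : E} :
    IsIntegral (valRing vF) x ↔ 0 ≤ vE x := by
  let _ := valRingAction hG
  let _ := valRingAlgebra h
  have := isGaloisGroup_valRing h hG
  have : IsScalarTower (valRing vF) (valRing vE) E := .of_algebraMap_eq fun _ => rfl
  have := IsGaloisGroup.isInvariant (G := E ≃ₐ[F] E) (A := valRing vF) (B := valRing vE)
  have := Algebra.IsInvariant.isIntegral (valRing vF) (valRing vE) (E ≃ₐ[F] E)
  constructor
  · intro hx
    obtain ⟨y, hy⟩ := IsIntegrallyClosed.isIntegral_iff.mp (hx.tower_top (A := valRing vE))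
    rw [← hy]
    exact y.2
  · intro hx
    exact (Algebra.IsIntegral.isIntegral (R := valRing vF)
      (⟨x, hx⟩ : valRing vE)).map (IsScalarTower.toAlgHom (valRing vF) (valRing vE) E)

lemma isIntegralClosure_valRing [FiniteDimensional F E] [IsGalois F E]
    (h : Extends vF vE e) (hG : GalInvariant F vE) :
    let _ := valRingAlgebra h
    IsIntegralClosure (valRing vE) (valRing vF) E := by
  let _ := valRingAlgebra h
  refine ⟨Subtype.val_injective, fun {x} => ?_⟩
  rw [isIntegral_valRing_iff h hG]
  exact ⟨fun hx => ⟨⟨x, hx⟩, rfl⟩, by rintro ⟨y, rfl⟩; exact y.2⟩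

set_option maxHeartbeats 2000000 in
lemma card_lowerRG_zero [FiniteDimensional F E] [IsGalois F E]
    (h : Extends vF vE e) (hG : GalInvariant F vE)
    (hF : IsNormalized vF) (hE : IsNormalized vE)
    [Finite (valRing vE ⧸ IsLocalRing.maximalIdeal (valRing vE))] :
    Nat.card (lowerRG vE hG 0) = e := by
  let _ := valRingAction hG
  let _ := valRingAlgebra h
  have := isGaloisGroup_valRing h hG
  have := isIntegralClosure_valRing h hG
  have := isDiscreteValuationRing_valRing hF
  have := isDiscreteValuationRing_valRing hE
  have : IsScalarTower (valRing vF) (valRing vE) E := .of_algebraMap_eq fun _ => rfl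
  have : IsScalarTower (valRing vF) F E := .of_algebraMap_eq fun _ => rfl
  have : Module.Finite (valRing vF) (valRing vE) :=
    IsIntegralClosure.finite (valRing vF) F E (valRing vE)
  have : FaithfulSMul (valRing vF) (valRing vE) := by
    rw [faithfulSMul_iff_algebraMap_injective]
    intro x y hxy
    exact Subtype.ext ((algebraMap F E).injective (congrArg Subtype.val hxy))
  have : Module.IsTorsionFree (valRing vF) (valRing vE) := inferInstance
  have : Module.Flat (valRing vF) (valRing vE) := inferInstance
  set p := IsLocalRing.maximalIdeal (valRing vF)
  set P := IsLocalRing.maximalIdeal (valRing vE)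
  have hlo : P.LiesOver p := by
    refine ⟨?_⟩
    ext x
    rw [Ideal.under_def, Ideal.mem_comap, mem_maximalIdeal_valRing, mem_maximalIdeal_valRing]
    change 1 ≤ vF x ↔ 1 ≤ vE (algebraMap F E x)
    by_cases hx : (x : F) = 0
    · simp [hx]
    · obtain ⟨n, hn⟩ := exists_val_eq (v := vF) hx
      rw [h.val_eq hn, hn]
      have := h.1
      norm_cast
      constructor
      · intro; nlinarith
      · intro h'; by_contra hc
        have : (e : ℤ) * n ≤ 0 := mul_nonpos_of_nonneg_of_nonpos (by omega) (by omega)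
        omega
  have : Finite (valRing vF ⧸ p) :=
    Finite.of_injective (Ideal.quotientMap P (algebraMap (valRing vF) (valRing vE)) hlo.over.le)
      (Ideal.quotientMap_injective' hlo.over.ge)
  have : Finite p.ResidueField :=
    Finite.of_surjective _ (Ideal.bijective_algebraMap_quotient_residueField p).2
  have hp0 : p ≠ ⊥ := IsDiscreteValuationRing.not_a_field _
  have key := Ideal.card_inertia_eq_ramificationIdxIn (G := E ≃ₐ[F] E) p P
  rw [Ideal.ramificationIdxIn_eq_ramificationIdx p P (E ≃ₐ[F] E),
    ← Ideal.ramificationIdx'_eq_ramificationIdx p P hp0,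
    Ideal.ramificationIdx'_spec (n := e)] at key
  · rw [← key]
    have : lowerRG vE hG 0 = P.inertia (E ≃ₐ[F] E) := by
      ext σ
      change (∀ x : E, 0 ≤ vE x → ((0 + 1 : ℤ) : WithTop ℤ) ≤ vE (σ x - x)) ↔
        ∀ x : valRing vE, σ • x - x ∈ P
      constructor
      · intro hσ x
        rw [mem_maximalIdeal_valRing]
        exact_mod_cast hσ x x.2
      · intro hσ x hx
        have := hσ ⟨x, hx⟩
        rw [mem_maximalIdeal_valRing] at this
        exact_mod_cast this
    rw [this]
  · rw [Ideal.map_le_iff_le_comap]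
    intro x hx
    rw [Ideal.mem_comap, mem_maximalIdeal_pow_valRing hE]
    rw [mem_maximalIdeal_valRing] at hx
    change _ ≤ vE (algebraMap F E x)
    by_cases hx0 : (x : F) = 0
    · simp [hx0]
    · obtain ⟨n, hn⟩ := exists_val_eq (v := vF) hx0
      rw [hn] at hx
      rw [h.val_eq hn]
      norm_cast at hx ⊢
      nlinarith
  · intro hle
    obtain ⟨ϖ, hϖ⟩ := hF 1
    have hmem : ϖ ∈ valRing vF := by rw [mem_valRing, hϖ]; norm_cast
    have h1 : (⟨ϖ, hmem⟩ : valRing vF) ∈ p := by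
      rw [mem_maximalIdeal_valRing, hϖ]; norm_cast
    have h2 := hle (Ideal.mem_map_of_mem _ h1)
    rw [mem_maximalIdeal_pow_valRing hE] at h2
    change _ ≤ vE (algebraMap F E ϖ) at h2
    rw [h.val_eq hϖ] at h2
    norm_cast at h2
    omega

end GaloisExtension

section Padic

variable {p : ℕ} [Fact p.Prime] {E : Type*} [Field E] [Algebra ℚ_[p] E]
  {v : AddValuation E (WithTop ℤ)} {e : ℕ}

lemma IsPadicValuation.val_natCast_prime (h : IsPadicValuation p v e) : v (p : E) = (e : ℤ) := by
  have hp : (p : ℚ_[p]) ≠ 0 := by exact_mod_cast (Fact.out : p.Prime).ne_zero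
  have := h.2.2 p hp
  rw [map_natCast, Padic.valuation_p, mul_one] at this
  exact this

lemma IsPadicValuation.one_le_val_natCast_prime (h : IsPadicValuation p v e) :
    1 ≤ v (p : E) := by
  rw [h.val_natCast_prime]
  exact_mod_cast h.2.1

lemma val_natCast_nonneg (n : ℕ) : 0 ≤ v (n : E) := by
  induction n with
  | zero => simp
  | succ n ih => push_cast; exact v.map_le_add ih (by simp)

lemma IsPadicValuation.one_le_val_algebraMap (h : IsPadicValuation p v e) {x : ℚ_[p]}
    (hx : ‖x‖ < 1) : 1 ≤ v (algebraMap ℚ_[p] E x) := by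
  by_cases h0 : x = 0
  · simp [h0]
  rw [h.2.2 x h0]
  have h1 : (1 : ℝ) < p := by exact_mod_cast (Fact.out : p.Prime).one_lt
  rw [Padic.norm_eq_zpow_neg_valuation h0, zpow_lt_one_iff_right₀ h1] at hx
  have := h.2.1
  norm_cast
  nlinarith

lemma IsPadicValuation.finite_residueField [FiniteDimensional ℚ_[p] E]
    (h : IsPadicValuation p v e) :
    Finite (valRing v ⧸ IsLocalRing.maximalIdeal (valRing v)) := by
  set k := valRing v ⧸ IsLocalRing.maximalIdeal (valRing v)
  have hpk : (p : k) = 0 := by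
    have : (p : k) = Ideal.Quotient.mk _ (p : valRing v) := by simp [k]
    rw [this, Ideal.Quotient.eq_zero_iff_mem, mem_maximalIdeal_valRing]
    exact_mod_cast h.one_le_val_natCast_prime
  let _ : Module (ZMod p) k := AddCommGroup.zmodModule fun x => by
    rw [nsmul_eq_mul, hpk, zero_mul]
  have hrank : Module.rank (ZMod p) k ≤ Module.finrank ℚ_[p] E := by
    refine rank_le fun s hs => ?_
    obtain ⟨b, hb⟩ : ∃ b : k → valRing v, ∀ x, Ideal.Quotient.mk _ (b x) = x :=
      ⟨_, Function.surjInv_eq Ideal.Quotient.mk_surjective⟩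
    have hli : LinearIndependent ℚ_[p] (fun i : s => (b i : E)) := by
      rw [Fintype.linearIndependent_iff]
      intro g hg
      by_contra! hne
      obtain ⟨i₁, hi₁⟩ := hne
      obtain ⟨i₀, -, hmax⟩ := Finset.exists_max_image Finset.univ (fun i => ‖g i‖) ⟨i₁, by simp⟩
      have hg0 : g i₀ ≠ 0 := by
        intro h0
        have := hmax i₁ (by simp)
        rw [h0, norm_zero, norm_le_zero_iff] at this
        exact hi₁ this
      have hc : ∀ i, ‖g i / g i₀‖ ≤ 1 := fun i => by
        rw [norm_div]
        exact div_le_one_of_le₀ (hmax i (by simp)) (norm_nonneg _)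
      have hn : ∀ i, ∃ n : ℕ, ‖g i / g i₀ - n‖ < 1 := fun i => by
        obtain ⟨n, -, hn⟩ := PadicInt.exists_mem_range (⟨g i / g i₀, hc i⟩ : ℤ_[p])
        refine ⟨n, ?_⟩
        have := PadicInt.mem_nonunits.mp hn
        rw [PadicInt.norm_def] at this
        exact_mod_cast this
      choose n hn using hn
      have hsum : ∑ i, algebraMap ℚ_[p] E (g i / g i₀) * (b i : E) = 0 := by
        have : ∑ i, algebraMap ℚ_[p] E (g i / g i₀) * (b i : E) =
            algebraMap ℚ_[p] E (g i₀)⁻¹ * ∑ i, g i • (b i : E) := by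
          rw [Finset.mul_sum]
          refine Finset.sum_congr rfl fun i _ => ?_
          rw [Algebra.smul_def, ← mul_assoc, ← map_mul, div_eq_inv_mul]
        rw [this, hg, mul_zero]
      have hsum' : ∑ i, (n i : ZMod p) • (i : k) = 0 := by
        have h1 : ∑ i, (n i : ZMod p) • (i : k) =
            Ideal.Quotient.mk _ (∑ i, (n i : valRing v) * b i) := by
          rw [map_sum]
          refine Finset.sum_congr rfl fun i _ => ?_
          rw [map_mul, hb, map_natCast, Nat.cast_smul_eq_nsmul, nsmul_eq_mul]
        rw [h1, Ideal.Quotient.eq_zero_iff_mem, mem_maximalIdeal_valRing]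
        have h2 : ((∑ i, (n i : valRing v) * b i : valRing v) : E) =
            - ∑ i, algebraMap ℚ_[p] E (g i / g i₀ - n i) * (b i : E) := by
          simp only [map_sub, sub_mul, Finset.sum_sub_distrib, hsum, map_natCast, zero_sub, neg_neg]
          push_cast
          rfl
        rw [h2, v.map_neg]
        refine v.map_le_sum fun i _ => ?_
        rw [v.map_mul]
        calc (1 : WithTop ℤ) = 1 + 0 := by simp
          _ ≤ _ := add_le_add (h.one_le_val_algebraMap (hn i)) (b i).2
      have h0 := Fintype.linearIndependent_iff.mp hs _ hsum' i₀
      rw [ZMod.natCast_eq_zero_iff] at h0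
      have h1 := h.one_le_val_algebraMap (hn i₀)
      rw [div_self hg0] at h1
      have h2 : 1 ≤ v ((n i₀ : ℕ) : E) := by
        obtain ⟨c, hc⟩ := h0
        rw [hc, Nat.cast_mul, v.map_mul]
        calc (1 : WithTop ℤ) = 1 + 0 := by simp
          _ ≤ _ := add_le_add h.one_le_val_natCast_prime (val_natCast_nonneg c)
      have h3 := v.map_le_add h1 h2
      rw [map_sub, map_one, map_natCast, sub_add_cancel, v.map_one] at h3
      exact absurd h3 (by norm_num)
    simpa using hli.fintype_card_le_finrank
  have : Module.Free (ZMod p) k := Module.Free.of_divisionRing (ZMod p) k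
  have : Module.Finite (ZMod p) k :=
    (@Module.rank_lt_aleph0_iff (ZMod p) k _ _ _ inferInstance inferInstance).mp
      (hrank.trans_lt Cardinal.natCast_lt_aleph0)
  exact @Module.finite_of_finite (ZMod p) k _ _ _ _ this

end Padic

section Monogenic

open Polynomial

variable {E : Type*} [Field E] {v : AddValuation E (WithTop ℤ)}

lemma dvd_valRing_of_val_eq_one {ϖ z : valRing v} (h : v (ϖ : E) = 1) :
    ϖ ∣ z ↔ z ∈ IsLocalRing.maximalIdeal (valRing v) := by
  rw [dvd_valRing_iff, h, mem_maximalIdeal_valRing]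

/-- Some `x` lifts a generator of the multiplicative group of the residue field `k`, while
`x ^ #k - x` is a uniformizer. -/
lemma exists_lift_generator (hv : IsNormalized v)
    [Finite (valRing v ⧸ IsLocalRing.maximalIdeal (valRing v))] :
    ∃ x : valRing v, ∃ q : ℕ, v ((x ^ q - x : valRing v) : E) = 1 ∧
      ∀ z : valRing v, z ∈ IsLocalRing.maximalIdeal (valRing v) ∨
        ∃ j : ℕ, z - x ^ j ∈ IsLocalRing.maximalIdeal (valRing v) := by
  set m := IsLocalRing.maximalIdeal (valRing v) with hm
  let _ : Field (valRing v ⧸ m) := Ideal.Quotient.field m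
  let _ : Fintype (valRing v ⧸ m) := Fintype.ofFinite _
  set q := Fintype.card (valRing v ⧸ m) with hq
  have hgen (x : valRing v) (u : (valRing v ⧸ m)ˣ) (hu : ∀ t, t ∈ Subgroup.zpowers u)
      (hx : Ideal.Quotient.mk m x = u) (z : valRing v) : z ∈ m ∨ ∃ j : ℕ, z - x ^ j ∈ m := by
    by_cases hz : z ∈ m
    · exact Or.inl hz
    right
    have hz0 : Ideal.Quotient.mk m z ≠ 0 := by rwa [Ne, Ideal.Quotient.eq_zero_iff_mem]
    obtain ⟨j, hj⟩ := mem_powers_iff_mem_zpowers.mpr (hu (Units.mk0 _ hz0))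
    refine ⟨j, ?_⟩
    have := congrArg Units.val hj
    simp only [Units.val_pow_eq_pow_val, Units.val_mk0] at this
    rw [← Ideal.Quotient.eq, ← this, map_pow, hx]
  obtain ⟨u, hu⟩ := IsCyclic.exists_generator (α := (valRing v ⧸ m)ˣ)
  obtain ⟨ζ, hζ⟩ := Ideal.Quotient.mk_surjective (u : valRing v ⧸ m)
  have hζq : ζ ^ q - ζ ∈ m := by
    rw [← Ideal.Quotient.eq, map_pow, hq, FiniteField.pow_card]
  have hqm : (q : valRing v) ∈ m := by
    rw [← Ideal.Quotient.eq_zero_iff_mem, map_natCast, hq, Nat.cast_card_eq_zero]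
  obtain ⟨π, hπ⟩ := hv 1
  have hπ' : v π = 1 := hπ
  have hmem : π ∈ valRing v := by rw [mem_valRing, hπ]; norm_cast
  by_cases h1 : v ((ζ ^ q - ζ : valRing v) : E) = 1
  · exact ⟨ζ, q, h1, hgen ζ u hu hζ⟩
  set P : valRing v := ⟨π, hmem⟩
  have hPm : P ∈ m := by rw [mem_maximalIdeal_valRing]; exact hπ'.ge
  refine ⟨ζ + P, q, ?_, hgen _ u hu ?_⟩
  · obtain ⟨c, hc⟩ := powAddExpansion ζ P q
    have h2 : (ζ ^ q - ζ) + (q * ζ ^ (q - 1) * P + c * P ^ 2) ∈ m ^ 2 := by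
      refine add_mem ?_ (add_mem ?_ ?_)
      · rw [mem_maximalIdeal_pow_valRing hv]
        rw [mem_maximalIdeal_valRing] at hζq
        by_cases h0 : ((ζ ^ q - ζ : valRing v) : E) = 0
        · rw [h0]; simp
        obtain ⟨n, hn⟩ := exists_val_eq (v := v) h0
        rw [hn] at hζq h1 ⊢
        norm_cast at *
        omega
      · rw [pow_two]
        exact Ideal.mul_mem_mul (Ideal.mul_mem_right _ _ hqm) hPm
      · exact Ideal.mul_mem_left _ _ (Ideal.pow_mem_pow hPm 2)
    rw [mem_maximalIdeal_pow_valRing hv] at h2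
    have h3 : (((ζ + P) ^ q - (ζ + P) : valRing v) : E) =
        ((ζ ^ q - ζ + (q * ζ ^ (q - 1) * P + c * P ^ 2) : valRing v) : E) - π := by
      rw [hc]; simp only [P]; push_cast; ring
    rw [h3, v.map_sub_eq_of_lt_right, hπ']
    rw [hπ']
    refine lt_of_lt_of_le ?_ h2
    norm_cast
  · rw [map_add, hζ, Ideal.Quotient.eq_zero_iff_mem.mpr hPm, add_zero]

/-- The valuation ring is the closure of `ℤ[x]` for some `x`. -/
lemma exists_dense_generator (hv : IsNormalized v)
    [Finite (valRing v ⧸ IsLocalRing.maximalIdeal (valRing v))] :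
    ∃ x : E, 0 ≤ v x ∧ ∀ y : E, 0 ≤ v y → ∀ N : ℕ, ∃ Q : ℤ[X],
      ((N : ℤ) : WithTop ℤ) ≤ v (y - aeval x Q) := by
  obtain ⟨x, q, hq, hx⟩ := exists_lift_generator hv
  have key : ∀ (N : ℕ) (y : valRing v), ∃ Q : ℤ[X], (x ^ q - x) ^ N ∣ y - aeval x Q := by
    intro N
    induction N with
    | zero => exact fun y => ⟨0, by simp⟩
    | succ N ih =>
      intro y
      obtain ⟨Q, z, hz⟩ := ih y
      obtain ⟨R, hR⟩ : ∃ R : ℤ[X], x ^ q - x ∣ z - aeval x R := by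
        rcases hx z with h | ⟨j, h⟩
        · exact ⟨0, by simpa [dvd_valRing_of_val_eq_one hq] using h⟩
        · exact ⟨X ^ j, by simpa [dvd_valRing_of_val_eq_one hq] using h⟩
      refine ⟨Q + (X ^ q - X) ^ N * R, ?_⟩
      have : y - aeval x (Q + (X ^ q - X) ^ N * R) = (x ^ q - x) ^ N * (z - aeval x R) := by
        simp only [map_add, map_mul, map_pow, map_sub, aeval_X]
        rw [mul_sub, ← hz]; ring
      rw [this, pow_succ]
      exact mul_dvd_mul_left _ hR
  refine ⟨x, x.2, fun y hy N => ?_⟩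
  obtain ⟨Q, hQ⟩ := key N ⟨y, hy⟩
  refine ⟨Q, ?_⟩
  have h1 : v ((x ^ q - x : valRing v) : E) = ((1 : ℤ) : WithTop ℤ) := hq
  rw [dvd_valRing_iff, SubmonoidClass.coe_pow, val_pow_eq h1, mul_one] at hQ
  have h2 : ((aeval x Q : valRing v) : E) = aeval (x : E) Q :=
    (aeval_algebraMap_apply E x Q).symm
  rwa [AddSubgroupClass.coe_sub, h2] at hQ

end Monogenic

section DenseGenerator

open Polynomial

variable {F E : Type*} [Field F] [Field E] [Algebra F E]
  {vF : AddValuation F (WithTop ℤ)} {v : AddValuation E (WithTop ℤ)} {e : ℕ} {x : E}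

/-- `x` lies in the valuation ring of `v`, and `ℤ[x]` is dense in it. -/
def IsDenseGenerator (v : AddValuation E (WithTop ℤ)) (x : E) : Prop :=
  0 ≤ v x ∧ ∀ y : E, 0 ≤ v y → ∀ N : ℕ, ∃ Q : ℤ[X], ((N : ℤ) : WithTop ℤ) ≤ v (y - aeval x Q)

/-- The valuation of `σ x - x`, with value `0` at `σ = 1`. -/
def ramDepth (v : AddValuation E (WithTop ℤ)) (x : E) (σ : E ≃ₐ[F] E) : ℤ :=
  (v (σ x - x)).untopD 0

lemma val_sub_le_val_aeval_sub {y : E} (hx : 0 ≤ v x) (hy : 0 ≤ v y) (Q : ℤ[X]) :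
    v (y - x) ≤ v (aeval y Q - aeval x Q) := by
  have h1 : ((aeval (⟨x, hx⟩ : valRing v) Q : valRing v) : E) = aeval x Q :=
    (aeval_algebraMap_apply E (⟨x, hx⟩ : valRing v) Q).symm
  have h2 : ((aeval (⟨y, hy⟩ : valRing v) Q : valRing v) : E) = aeval y Q :=
    (aeval_algebraMap_apply E (⟨y, hy⟩ : valRing v) Q).symm
  rw [← h1, ← h2]
  have := sub_dvd_eval_sub (⟨y, hy⟩ : valRing v) ⟨x, hx⟩ (Q.map (algebraMap ℤ (valRing v)))
  rw [eval_map_algebraMap, eval_map_algebraMap, dvd_valRing_iff] at this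
  exact this

lemma IsDenseGenerator.mem_lowerRG_iff (hx : IsDenseGenerator v x) (hG : GalInvariant F v)
    {σ : E ≃ₐ[F] E} {j : ℤ} :
    σ ∈ lowerRG v hG j ↔ ((j + 1 : ℤ) : WithTop ℤ) ≤ v (σ x - x) := by
  refine ⟨fun h => h x hx.1, fun h y hy => ?_⟩
  obtain ⟨Q, hQ⟩ := hx.2 y hy (j + 1).toNat
  have hN : ((j + 1 : ℤ) : WithTop ℤ) ≤ v (y - aeval x Q) :=
    le_trans (by exact_mod_cast Int.self_le_toNat _) hQ
  have hs : σ y - y = σ (y - aeval x Q) + (aeval (σ x) Q - aeval x Q) - (y - aeval x Q) := by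
    have : σ (aeval x Q) = aeval (σ x) Q := by
      have := aeval_algHom_apply (σ.toAlgHom.restrictScalars ℤ) x Q
      exact this.symm
    rw [map_sub, this]; ring
  rw [hs]
  refine v.map_le_sub (v.map_le_add ?_ ?_) hN
  · rwa [hG]
  · exact h.trans (val_sub_le_val_aeval_sub hx.1 (by rw [hG]; exact hx.1) Q)

lemma IsDenseGenerator.eq_one_of_apply_eq (hx : IsDenseGenerator v x) (hG : GalInvariant F v)
    {σ : E ≃ₐ[F] E} (h : σ x = x) : σ = 1 := by
  have key : ∀ y, 0 ≤ v y → σ y = y := fun y hy => by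
    by_contra hne
    obtain ⟨n, hn⟩ := exists_val_eq (v := v) (sub_ne_zero.mpr hne)
    have := (hx.mem_lowerRG_iff hG (σ := σ) (j := n)).mpr (by simp [h]) y hy
    rw [hn] at this
    norm_cast at this
    omega
  ext y
  obtain ⟨a, b, hb, rfl⟩ := IsFractionRing.div_surjective (A := valRing v) y
  change σ ((a : E) / b) = (a : E) / b
  rw [map_div₀, key a a.2, key b b.2]

lemma IsDenseGenerator.coe_ramDepth (hx : IsDenseGenerator v x) (hG : GalInvariant F v)
    {σ : E ≃ₐ[F] E} (h : σ ≠ 1) : v (σ x - x) = (ramDepth v x σ : WithTop ℤ) := by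
  obtain ⟨n, hn⟩ := exists_val_eq (v := v)
    (sub_ne_zero.mpr fun h' => h (hx.eq_one_of_apply_eq hG h'))
  rw [ramDepth, hn]; rfl

@[simp] lemma ramDepth_one : ramDepth v x (1 : E ≃ₐ[F] E) = 0 := by
  simp [ramDepth]

lemma IsDenseGenerator.mem_lowerRG_iff_lt_ramDepth (hx : IsDenseGenerator v x)
    (hG : GalInvariant F v) {σ : E ≃ₐ[F] E} (h : σ ≠ 1) {j : ℤ} :
    σ ∈ lowerRG v hG j ↔ j < ramDepth v x σ := by
  rw [hx.mem_lowerRG_iff hG, hx.coe_ramDepth hG h]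
  norm_cast

lemma IsDenseGenerator.ramDepth_nonneg (hx : IsDenseGenerator v x)
    (hG : GalInvariant F v) (σ : E ≃ₐ[F] E) : 0 ≤ ramDepth v x σ := by
  by_cases h : σ = 1
  · simp [h]
  · have : 0 ≤ v (σ x - x) := by
      refine v.map_le_sub ?_ hx.1
      rw [hG]; exact hx.1
    rw [hx.coe_ramDepth hG h] at this
    exact_mod_cast this

lemma val_prod_eq {ι : Type*} {s : Finset ι} {f : ι → E} {n : ι → ℤ}
    (h : ∀ i ∈ s, v (f i) = (n i : WithTop ℤ)) :
    v (∏ i ∈ s, f i) = ((∑ i ∈ s, n i : ℤ) : WithTop ℤ) := by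
  induction s using Finset.induction_on with
  | empty => simp
  | insert a s ha ih =>
    rw [Finset.prod_insert ha, Finset.sum_insert ha]
    exact val_mul_eq (h a (Finset.mem_insert_self a s))
      (ih fun i hi => h i (Finset.mem_insert_of_mem hi))

section Galois

variable [FiniteDimensional F E] [IsGalois F E]

lemma IsDenseGenerator.map_minpoly (hx : IsDenseGenerator v x) (hG : GalInvariant F v) :
    (minpoly F x).map (algebraMap F E) = ∏ σ : E ≃ₐ[F] E, (X - C (σ x)) := by
  have hint := Algebra.IsIntegral.isIntegral (R := F) x
  have hinj : Function.Injective fun σ : E ≃ₐ[F] E => σ x := fun σ τ h => by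
    have h1 : (τ⁻¹ * σ) x = x := by
      rw [AlgEquiv.mul_apply]
      rw [show σ x = τ x from h]
      exact τ.symm_apply_apply x
    exact (inv_mul_eq_one.mp (hx.eq_one_of_apply_eq hG h1)).symm
  have hmon : (∏ σ : E ≃ₐ[F] E, (X - C (σ x))).Monic := monic_prod_of_monic _ _ fun σ _ =>
    monic_X_sub_C _
  have hdvd : ∏ σ : E ≃ₐ[F] E, (X - C (σ x)) ∣ (minpoly F x).map (algebraMap F E) := by
    refine Finset.prod_dvd_of_coprime ?_ fun σ _ => ?_
    · exact (pairwise_coprime_X_sub_C hinj).set_pairwise _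
    · rw [dvd_iff_isRoot, IsRoot.def, eval_map_algebraMap, aeval_algHom_apply σ x,
        minpoly.aeval, map_zero]
  refine eq_of_monic_of_dvd_of_natDegree_le hmon ((minpoly.monic hint).map _) hdvd ?_
  rw [natDegree_map, natDegree_prod_of_monic _ _ fun σ _ => monic_X_sub_C _]
  simp only [natDegree_X_sub_C, Finset.sum_const, Finset.card_univ, smul_eq_mul, mul_one]
  rw [← Nat.card_eq_fintype_card, IsGalois.card_aut_eq_finrank]
  exact minpoly.natDegree_le x

lemma IsDenseGenerator.adjoin_eq_top (hx : IsDenseGenerator v x) (hG : GalInvariant F v) :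
    Algebra.adjoin F {x} = ⊤ := by
  have hint := Algebra.IsIntegral.isIntegral (R := F) x
  have h : (minpoly F x).natDegree = Module.finrank F E := by
    rw [← natDegree_map (algebraMap F E), hx.map_minpoly hG,
      natDegree_prod_of_monic _ _ fun σ _ => monic_X_sub_C _]
    simp only [natDegree_X_sub_C, Finset.sum_const, Finset.card_univ, smul_eq_mul, mul_one]
    rw [← Nat.card_eq_fintype_card, IsGalois.card_aut_eq_finrank]
  rw [← IntermediateField.adjoin_simple_toSubalgebra_of_isAlgebraic hint.isAlgebraic,
    (Field.primitive_element_iff_minpoly_natDegree_eq F x).mpr h, IntermediateField.top_toSubalgebra]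

lemma IsDenseGenerator.val_aeval_derivative (hx : IsDenseGenerator v x) (hG : GalInvariant F v) :
    v (aeval x (derivative (minpoly F x))) =
      ((∑ σ : E ≃ₐ[F] E, ramDepth v x σ : ℤ) : WithTop ℤ) := by
  have h1 : aeval x (derivative (minpoly F x)) =
      ∏ σ ∈ ({1}ᶜ : Finset (E ≃ₐ[F] E)), (x - σ x) := by
    rw [← eval_map_algebraMap, ← derivative_map, hx.map_minpoly hG,
      Fintype.prod_eq_mul_prod_compl 1]
    simp [derivative_mul, eval_prod]
  rw [h1, val_prod_eq (n := ramDepth v x), Fintype.sum_eq_add_sum_compl 1, ramDepth_one, zero_add]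
  intro σ hσ
  rw [v.map_sub_swap, hx.coe_ramDepth hG (by simpa using hσ)]

/-- The inverse different is the fractional ideal of valuation `-∑ v (σ x - x)`. -/
lemma IsDenseGenerator.forall_trace_nonneg_iff (hx : IsDenseGenerator v x)
    (h : Extends vF v e) (hG : GalInvariant F v) {z : E} :
    (∀ y : E, 0 ≤ v y → 0 ≤ vF (Algebra.trace F E (z * y))) ↔
      ((-∑ σ : E ≃ₐ[F] E, ramDepth v x σ : ℤ) : WithTop ℤ) ≤ v z := by
  have : IsScalarTower (valRing vF) F E := .of_algebraMap_eq fun _ => rfl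
  set D := aeval x (derivative (minpoly F x)) with hD
  have hDv := hx.val_aeval_derivative hG
  rw [← hD] at hDv
  have hD0 := ne_zero_of_val_eq hDv
  set M := ∑ σ : E ≃ₐ[F] E, ramDepth v x σ
  set R := Algebra.adjoin (valRing vF) {x} with hR
  have hdual := traceForm_dualSubmodule_adjoin (valRing vF) F (hx.adjoin_eq_top hG)
    ((isIntegral_valRing_iff h hG).mpr hx.1)
  rw [← hR, ← hD] at hdual
  have hmem1 : ∀ a : F, a ∈ (1 : Submodule (valRing vF) F) ↔ 0 ≤ vF a := fun a => by
    rw [Submodule.mem_one]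
    exact ⟨by rintro ⟨b, rfl⟩; exact b.2, fun ha => ⟨⟨a, ha⟩, rfl⟩⟩
  have htr : ∀ y, 0 ≤ v y → 0 ≤ vF (Algebra.trace F E y) := fun y hy => by
    have := Algebra.isIntegral_trace (L := F) ((isIntegral_valRing_iff h hG).mpr hy)
    obtain ⟨b, hb⟩ := IsIntegrallyClosed.isIntegral_iff.mp this
    rw [← hb]; exact b.2
  have hRv : ∀ r ∈ R, 0 ≤ v r := fun r hr => by
    have hle : R ≤ integralClosure (valRing vF) E := Algebra.adjoin_le (by
      rintro _ rfl
      exact (isIntegral_valRing_iff h hG).mpr hx.1)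
    exact (isIntegral_valRing_iff h hG).mp (hle hr)
  have hdiv : ∀ y, 0 ≤ v y → D * y ∈ R := fun y hy => by
    have : y ∈ (Algebra.traceForm F E).dualSubmodule (Subalgebra.toSubmodule R) := by
      rw [LinearMap.BilinForm.mem_dualSubmodule]
      intro r hr
      rw [hmem1, Algebra.traceForm_apply]
      refine htr _ ?_
      rw [v.map_mul]
      exact add_nonneg hy (hRv r hr)
    rw [hdual] at this
    obtain ⟨r, hr, rfl⟩ := this
    change D * (D⁻¹ • r) ∈ R
    rw [smul_eq_mul, mul_inv_cancel_left₀ hD0]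
    exact hr
  have hOR : ∀ y, y ∈ R ↔ 0 ≤ v y := fun y => by
    refine ⟨hRv y, fun hy => ?_⟩
    obtain ⟨Q, hQ⟩ := hx.2 y hy M.toNat
    have hQR : aeval x Q ∈ R := by
      have := aeval_mem_adjoin_singleton (valRing vF) x (p := Q.map (algebraMap ℤ (valRing vF)))
      rwa [aeval_map_algebraMap] at this
    have hw : D * (D⁻¹ * (y - aeval x Q)) ∈ R := by
      refine hdiv _ ?_
      rw [v.map_mul, val_inv_eq hDv]
      have : ((M : ℤ) : WithTop ℤ) ≤ v (y - aeval x Q) :=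
        le_trans (by exact_mod_cast Int.self_le_toNat _) hQ
      calc (0 : WithTop ℤ) = ((-M : ℤ) : WithTop ℤ) + (M : WithTop ℤ) := by norm_cast; omega
        _ ≤ _ := add_le_add le_rfl this
    rw [mul_inv_cancel_left₀ hD0] at hw
    simpa using add_mem hw hQR
  have hz : (∀ y : E, 0 ≤ v y → 0 ≤ vF (Algebra.trace F E (z * y))) ↔
      z ∈ (Algebra.traceForm F E).dualSubmodule (Subalgebra.toSubmodule R) := by
    rw [LinearMap.BilinForm.mem_dualSubmodule]
    simp only [Subalgebra.mem_toSubmodule, hOR, hmem1, Algebra.traceForm_apply]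
  rw [hz, hdual]
  constructor
  · rintro ⟨r, hr, rfl⟩
    change _ ≤ v (D⁻¹ • r)
    rw [smul_eq_mul, v.map_mul, val_inv_eq hDv]
    exact le_add_of_nonneg_right (hRv r hr)
  · intro hle
    refine ⟨D * z, (hOR _).mpr ?_, ?_⟩
    · rw [v.map_mul, hDv]
      calc (0 : WithTop ℤ) = (M : WithTop ℤ) + ((-M : ℤ) : WithTop ℤ) := by norm_cast; omega
        _ ≤ _ := add_le_add le_rfl hle
    · change D⁻¹ • (D * z) = z
      rw [smul_eq_mul, inv_mul_cancel_left₀ hD0]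

end Galois

end DenseGenerator

section Tower

variable {K L E : Type*} [Field K] [Field L] [Field E] [Algebra K L] [Algebra L E] [Algebra K E]
  [IsScalarTower K L E]
  {vK : AddValuation K (WithTop ℤ)} {vL : AddValuation L (WithTop ℤ)}
  {vE : AddValuation E (WithTop ℤ)} {eL eE e : ℕ}

lemma GalInvariant.tower_top (L : Type*) [Field L] [Algebra K L] [Algebra L E]
    [IsScalarTower K L E] (hG : GalInvariant K vE) : GalInvariant L vE :=
  fun σ x => hG (σ.restrictScalars K) x

lemma Extends.nonneg_of_nonneg [FiniteDimensional K E] [IsGalois K E]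
    (hL : Extends vK vL eL) (hE : Extends vK vE eE) (hG : GalInvariant K vE) {x : L}
    (hx : 0 ≤ vE (algebraMap L E x)) : 0 ≤ vL x := by
  let _ := valRingAlgebra hL
  have : IsScalarTower (valRing vK) (valRing vL) L := .of_algebraMap_eq fun _ => rfl
  have : IsScalarTower (valRing vK) L E := .of_algebraMap_eq fun x =>
    IsScalarTower.algebraMap_apply K L E x
  have h1 : IsIntegral (valRing vK) x :=
    (isIntegral_algebraMap_iff (algebraMap L E).injective).mp
      ((isIntegral_valRing_iff hE hG).mpr hx)
  obtain ⟨y, hy⟩ := IsIntegrallyClosed.isIntegral_iff.mp (h1.tower_top (A := valRing vL))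
  rw [← hy]
  exact y.2

/-- Uniqueness of the extension of a valuation, in the middle of a tower. -/
lemma Extends.exists_extends_top [FiniteDimensional K E] [IsGalois K E]
    (hvL : IsNormalized vL) (hL : Extends vK vL eL) (hE : Extends vK vE eE)
    (hG : GalInvariant K vE) : ∃ e, Extends vL vE e := by
  obtain ⟨t, ht⟩ := hvL 1
  have ht0 := ne_zero_of_val_eq ht
  have hinj : ∀ {x : L}, x ≠ 0 → algebraMap L E x ≠ 0 := fun h =>
    (map_ne_zero (algebraMap L E)).mpr h
  obtain ⟨c, hc⟩ := exists_val_eq (v := vE) (hinj ht0)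
  have key : ∀ (x : L) (m n : ℤ), vE (algebraMap L E x) = (m : WithTop ℤ) →
      vL x = (n : WithTop ℤ) → m = c * n := by
    intro x m n hm hn
    have h1 : vE (algebraMap L E (x ^ c * t ^ (-m))) = ((c * m + (-m) * c : ℤ) : WithTop ℤ) := by
      rw [map_mul, map_zpow₀, map_zpow₀]
      exact val_mul_eq (val_zpow_eq hm c) (val_zpow_eq hc (-m))
    have h2 : vL (x ^ c * t ^ (-m)) = ((c * n + (-m) * 1 : ℤ) : WithTop ℤ) :=
      val_mul_eq (val_zpow_eq hn c) (val_zpow_eq ht (-m))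
    have h3 : 0 ≤ vL (x ^ c * t ^ (-m)) := hL.nonneg_of_nonneg hE hG (by
      rw [h1]; norm_cast; linarith)
    have h4 : 0 ≤ vL (x ^ c * t ^ (-m))⁻¹ := hL.nonneg_of_nonneg hE hG (by
      rw [map_inv₀, val_inv_eq h1]; norm_cast; linarith)
    rw [val_inv_eq h2] at h4
    rw [h2] at h3
    norm_cast at h3 h4
    linarith
  have hc0 : 0 < c := by
    by_contra hneg
    have h3 : 0 ≤ vL t⁻¹ := hL.nonneg_of_nonneg hE hG (by
      rw [map_inv₀, val_inv_eq hc]; norm_cast; linarith)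
    rw [val_inv_eq ht] at h3
    norm_cast at h3
  refine ⟨c.toNat, by omega, fun x => ?_⟩
  by_cases hx : x = 0
  · have : c.toNat ≠ 0 := by omega
    subst hx
    obtain ⟨k, hk⟩ := Nat.exists_eq_succ_of_ne_zero this
    rw [hk, succ_nsmul]
    simp
  · obtain ⟨n, hn⟩ := exists_val_eq (v := vL) hx
    obtain ⟨m, hm⟩ := exists_val_eq (v := vE) (hinj hx)
    rw [hm, hn, key x m n hm hn, ← WithTop.coe_nsmul, nsmul_eq_mul, Int.natCast_toNat_eq_self.mpr hc0.le]

/-- Existence of the normalized valuation on an intermediate field. -/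
lemma Extends.exists_intermediate (hvK : IsNormalized vK) (hE : Extends vK vE eE) :
    ∃ (vL : AddValuation L (WithTop ℤ)) (eL : ℕ), IsNormalized vL ∧ Extends vK vL eL := by
  set w : AddValuation L (WithTop ℤ) := vE.comap (algebraMap L E) with hw
  have hwK : Extends vK w eE := ⟨hE.1, fun x => by
    change vE (algebraMap L E (algebraMap K L x)) = _
    rw [← IsScalarTower.algebraMap_apply, hE.2]⟩
  let S : AddSubgroup ℤ :=
    { carrier := {n | ∃ x : L, w x = (n : WithTop ℤ)}
      zero_mem' := ⟨1, by simp⟩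
      add_mem' := by
        rintro a b ⟨x, hx⟩ ⟨y, hy⟩
        exact ⟨x * y, val_mul_eq hx hy⟩
      neg_mem' := by
        rintro a ⟨x, hx⟩
        exact ⟨x⁻¹, val_inv_eq hx⟩ }
  obtain ⟨a, ha⟩ := Int.subgroup_cyclic S
  have hS : ∀ n : ℤ, (∃ x : L, w x = (n : WithTop ℤ)) ↔ |a| ∣ n := fun n => by
    change n ∈ S ↔ _
    rw [ha, AddSubgroup.mem_closure_singleton, abs_dvd]
    simp only [smul_eq_mul, dvd_iff_exists_eq_mul_left, eq_comm]
  set g := |a|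
  obtain ⟨ϖ, hϖ⟩ := hvK 1
  have hwϖ := hwK.val_eq hϖ
  have hgd : g ∣ eE * 1 := (hS _).mp ⟨_, hwϖ⟩
  have heE := hE.1
  have hg : 0 < g := by
    refine lt_of_le_of_ne (abs_nonneg a) fun h0 => ?_
    rw [← h0, zero_dvd_iff] at hgd
    omega
  let f : L → WithTop ℤ := fun x => (w x).map (· / g)
  have hf : ∀ {x : L} {n : ℤ}, w x = ((g * n : ℤ) : WithTop ℤ) → f x = (n : WithTop ℤ) := by
    intro x n hx
    change (w x).map (· / g) = _
    rw [hx, WithTop.map_coe, Int.mul_ediv_cancel_left _ hg.ne']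
  have hex : ∀ {x : L}, x ≠ 0 → ∃ n : ℤ, w x = ((g * n : ℤ) : WithTop ℤ) := by
    intro x hx
    obtain ⟨m, hm⟩ := exists_val_eq (v := w) hx
    obtain ⟨n, rfl⟩ := (hS m).mp ⟨x, hm⟩
    exact ⟨n, hm⟩
  have hf0 : f 0 = ⊤ := by simp [f]
  have hmono : Monotone (WithTop.map (· / g) : WithTop ℤ → WithTop ℤ) :=
    Monotone.withTop_map fun x y hxy => Int.ediv_le_ediv hg hxy
  let vL : AddValuation L (WithTop ℤ) := AddValuation.of f hf0
    (by rw [hf (n := 0) (by simp)]; rfl)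
    (fun x y => by
      change min ((w x).map _) ((w y).map _) ≤ (w (x + y)).map _
      rw [← hmono.map_min]
      exact hmono (w.map_add x y))
    (fun x y => by
      by_cases hx : x = 0
      · simp [hx, hf0]
      by_cases hy : y = 0
      · simp [hy, hf0]
      obtain ⟨n, hn⟩ := hex hx
      obtain ⟨m, hm⟩ := hex hy
      rw [hf hn, hf hm, hf (n := n + m) (by rw [val_mul_eq hn hm, mul_add])]
      rfl)
  obtain ⟨k, hk⟩ := hgd
  have hk0 : 0 < k := by
    by_contra hneg
    have : g * k ≤ 0 := mul_nonpos_of_nonneg_of_nonpos hg.le (by omega)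
    omega
  refine ⟨vL, k.toNat, fun n => ?_, by omega, fun x => ?_⟩
  · obtain ⟨x, hx⟩ := (hS (g * n)).mpr (dvd_mul_right _ _)
    exact ⟨x, hf hx⟩
  · by_cases hx : x = 0
    · obtain ⟨j, hj⟩ := Nat.exists_eq_succ_of_ne_zero (show k.toNat ≠ 0 by omega)
      subst hx
      rw [hj, succ_nsmul]
      simp
    · obtain ⟨m, hm⟩ := exists_val_eq (v := vK) hx
      rw [hm, ← WithTop.coe_nsmul, nsmul_eq_mul, Int.natCast_toNat_eq_self.mpr hk0.le]
      refine hf ?_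
      rw [hwK.val_eq hm, ← mul_assoc, ← hk, mul_one]

/-- Transitivity of the different, in a tower with monogenic top. -/
lemma IsDenseGenerator.forall_trace_nonneg_iff_of_tower [FiniteDimensional K E]
    [FiniteDimensional L E] [IsGalois K E]
    {x : E} (hx : IsDenseGenerator vE x) (hvL : IsNormalized vL) (hvE : IsNormalized vE)
    (hE : Extends vK vE eE) (hLE : Extends vL vE e) (hG : GalInvariant K vE) {z : L} :
    (∀ y : L, 0 ≤ vL y → 0 ≤ vK (Algebra.trace K L (z * y))) ↔
      ((-(∑ σ : E ≃ₐ[K] E, ramDepth vE x σ - ∑ σ : E ≃ₐ[L] E, ramDepth vE x σ) : ℤ) :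
        WithTop ℤ) ≤ vE (algebraMap L E z) := by
  have : IsGalois L E := IsGalois.tower_top_of_isGalois K L E
  have : FiniteDimensional K L := FiniteDimensional.left K L E
  have hGL := hG.tower_top L
  have dK := fun z => hx.forall_trace_nonneg_iff hE hG (z := z)
  have dL := fun z => hx.forall_trace_nonneg_iff hLE hGL (z := z)
  set MK := ∑ σ : E ≃ₐ[K] E, ramDepth vE x σ
  set ML := ∑ σ : E ≃ₐ[L] E, ramDepth vE x σ
  obtain ⟨w, hw⟩ := hvE (-ML)
  have hw0 := ne_zero_of_val_eq hw
  have hwL : ∀ y : E, 0 ≤ vE y → 0 ≤ vL (Algebra.trace L E (w * y)) := (dL w).mpr hw.ge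
  obtain ⟨y₀, hy₀, hy₁⟩ : ∃ y : E, 0 ≤ vE y ∧ Algebra.trace L E (w * y) = 1 := by
    obtain ⟨t, ht⟩ := hvL 1
    have hwt : ¬ ((-ML : ℤ) : WithTop ℤ) ≤ vE (algebraMap L E t⁻¹ * w) := by
      rw [val_mul_eq (hLE.val_eq (val_inv_eq ht)) hw]
      have := hLE.1
      norm_cast
      omega
    rw [← dL] at hwt
    push Not at hwt
    obtain ⟨y, hy, hlt⟩ := hwt
    have hu := hwL y hy
    rw [mul_assoc, ← Algebra.smul_def, map_smul, smul_eq_mul, vL.map_mul, val_inv_eq ht] at hlt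
    set u := Algebra.trace L E (w * y) with hudef
    have hu0 : u ≠ 0 := by
      intro h0
      rw [h0] at hlt
      simp at hlt
    obtain ⟨n, hn⟩ := exists_val_eq (v := vL) hu0
    rw [hn] at hlt hu
    norm_cast at hlt hu
    have hn0 : n = 0 := by
      have : (-1 : ℤ) + n < 0 := by exact_mod_cast hlt
      omega
    refine ⟨algebraMap L E u⁻¹ * y, ?_, ?_⟩
    · rw [vE.map_mul, hLE.val_eq (val_inv_eq hn), hn0]
      simpa using hy
    · rw [mul_left_comm, ← Algebra.smul_def, map_smul, ← hudef, smul_eq_mul, inv_mul_cancel₀ hu0]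
  have htr : ∀ (a : L) (b : E), Algebra.trace K E (algebraMap L E a * b) =
      Algebra.trace K L (a * Algebra.trace L E b) := fun a b => by
    rw [← Algebra.trace_trace (S := L), ← Algebra.smul_def, map_smul, smul_eq_mul]
  have hzw : ((-(MK - ML) : ℤ) : WithTop ℤ) ≤ vE (algebraMap L E z) ↔
      ((-MK : ℤ) : WithTop ℤ) ≤ vE (algebraMap L E z * w) := by
    by_cases hz : z = 0
    · simp [hz]
    obtain ⟨n, hn⟩ := exists_val_eq (v := vE) ((map_ne_zero (algebraMap L E)).mpr hz)
    rw [val_mul_eq hn hw, hn]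
    norm_cast
    constructor <;> intro <;> linarith
  rw [hzw, ← dK]
  constructor
  · intro h y hy
    rw [mul_assoc, htr]
    exact h _ (hwL y hy)
  · intro h y hy
    have h1 := h (algebraMap L E y * y₀) (by
      rw [vE.map_mul]
      exact add_nonneg (hLE.nonneg_iff.mpr hy) hy₀)
    rwa [show algebraMap L E z * w * (algebraMap L E y * y₀) =
      algebraMap L E (z * y) * (w * y₀) by rw [map_mul]; ring, htr, hy₁, mul_one] at h1

lemma IsDenseGenerator.differentVal_lt_iff [FiniteDimensional K E]
    [FiniteDimensional L E] [IsGalois K E]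
    {x : E} (hx : IsDenseGenerator vE x) (hvL : IsNormalized vL) (hvE : IsNormalized vE)
    (hE : Extends vK vE eE) (hLE : Extends vL vE e) (hG : GalInvariant K vE) {c : ℤ} :
    differentVal K vK vL < c ↔
      ∑ σ : E ≃ₐ[K] E, ramDepth vE x σ - ∑ σ : E ≃ₐ[L] E, ramDepth vE x σ < c * e := by
  have h1 : ∀ z : L, _ := fun z => hx.forall_trace_nonneg_iff_of_tower hvL hvE hE hLE hG (z := z)
  set D := ∑ σ : E ≃ₐ[K] E, ramDepth vE x σ - ∑ σ : E ≃ₐ[L] E, ramDepth vE x σ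
  have he : (0 : ℤ) < e := by exact_mod_cast hLE.1
  have hset : {m : ℤ | ∃ z : L, vL z = ((-m : ℤ) : WithTop ℤ) ∧
      ∀ y : L, 0 ≤ vL y → 0 ≤ vK (Algebra.trace K L (z * y))} = Set.Iic (D / e) := by
    ext m
    rw [Set.mem_ofPred_eq, Set.mem_Iic, Int.le_ediv_iff_mul_le he]
    have h2 : ∀ z : L, vL z = ((-m : ℤ) : WithTop ℤ) →
        (((-D : ℤ) : WithTop ℤ) ≤ vE (algebraMap L E z) ↔ m * e ≤ D) := fun z hz => by
      rw [hLE.val_eq hz]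
      norm_cast
      constructor <;> intro <;> nlinarith
    constructor
    · rintro ⟨z, hz, hy⟩
      exact (h2 z hz).mp ((h1 z).mp hy)
    · intro hm
      obtain ⟨z, hz⟩ := hvL (-m)
      exact ⟨z, hz, (h1 z).mpr ((h2 z hz).mpr hm)⟩
  rw [differentVal, hset, csSup_Iic, Int.ediv_lt_iff_lt_mul he]

end Tower

lemma lowerRG_antitone {F E : Type*} [Field F] [Field E] [Algebra F E]
    {v : AddValuation E (WithTop ℤ)} (hG : GalInvariant F v) : Antitone (lowerRG v hG) := by
  intro i j hij σ hσ x hx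
  refine le_trans ?_ (hσ x hx)
  exact_mod_cast (by omega : i + 1 ≤ j + 1)

section Herbrand

variable {F E : Type*} [Field F] [Field E] [Algebra F E] [FiniteDimensional F E]
  {v : AddValuation E (WithTop ℤ)}

lemma card_mul_one_add_herbrandPhi (hG : GalInvariant F v) (n : ℕ) :
    (Nat.card (lowerRG v hG 0) : ℚ) * (1 + herbrandPhi v hG n) =
      ∑ j ∈ Finset.range (n + 1), (Nat.card (lowerRG v hG j) : ℚ) := by
  have h0 : (Nat.card (lowerRG v hG 0) : ℚ) ≠ 0 := by
    exact_mod_cast Nat.card_pos.ne'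
  rcases Nat.eq_zero_or_pos n with rfl | hn
  · simp [herbrandPhi]
  · rw [herbrandPhi, if_neg (by omega), mul_add, mul_one, mul_div_cancel₀ _ h0,
      Finset.sum_range_succ', add_comm]
    congr 1
    symm
    refine Finset.sum_nbij (fun j : ℕ => (j + 1 : ℤ)) ?_ ?_ ?_ ?_
    · intro j hj
      simp only [Finset.mem_range, Finset.mem_Icc] at hj ⊢
      omega
    · intro a _ b _ hab
      simpa using hab
    · intro j hj
      simp only [Finset.coe_Icc, Set.mem_Icc, Finset.coe_range, Set.mem_image, Set.mem_Iio] at hj ⊢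
      exact ⟨(j - 1).toNat, by omega, by omega⟩
    · intro j _
      push_cast
      rfl

lemma exists_upperRG_eq_lowerRG (hG : GalInvariant F v) {ν : ℤ} (hν : 0 < ν) :
    ∃ n : ℕ, upperRG v hG ν = lowerRG v hG (n + 1) ∧
      herbrandPhi v hG n < ν ∧ ν ≤ herbrandPhi v hG ((n + 1 : ℕ) : ℤ) := by
  set S := {n : ℤ | (ν : ℚ) ≤ herbrandPhi v hG n} with hS
  have hpos : ∀ n ∈ S, 1 ≤ n := by
    intro n hn
    by_contra hneg
    have hn' : (ν : ℚ) ≤ herbrandPhi v hG n := hn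
    rw [herbrandPhi, if_pos (by omega)] at hn'
    have : ν ≤ n := by exact_mod_cast hn'
    omega
  have hbdd : BddBelow S := ⟨1, hpos⟩
  have hne : S.Nonempty := by
    set g := Nat.card (lowerRG v hG 0)
    have hg : (0 : ℚ) < g := by exact_mod_cast Nat.card_pos
    refine ⟨((ν.toNat * g : ℕ) : ℤ), ?_⟩
    change (ν : ℚ) ≤ _
    have h1 := card_mul_one_add_herbrandPhi hG (ν.toNat * g)
    have h3 : (g : ℚ) + ν * g ≤ ∑ j ∈ Finset.range (ν.toNat * g + 1),
        (Nat.card (lowerRG v hG j) : ℚ) := by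
      rw [Finset.sum_range_succ', add_comm]
      refine add_le_add ?_ (by simp [g])
      calc (ν * g : ℚ) = ∑ j ∈ Finset.range (ν.toNat * g), (1 : ℚ) := by
            have : (ν.toNat : ℚ) = ν := by
              exact_mod_cast congrArg (Int.cast (R := ℚ)) (Int.toNat_of_nonneg hν.le)
            simp only [Finset.sum_const, Finset.card_range, nsmul_eq_mul, mul_one, Nat.cast_mul]
            rw [this]
        _ ≤ _ := Finset.sum_le_sum fun j _ => by exact_mod_cast Nat.card_pos
    rw [← h1] at h3
    have h4 : (g : ℚ) * ν ≤ g * herbrandPhi v hG ((ν.toNat * g : ℕ) : ℤ) := by linarith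
    exact le_of_mul_le_mul_left h4 hg
  have hmem := Int.csInf_mem hne hbdd
  have h1 := hpos _ hmem
  obtain ⟨n, hn⟩ : ∃ n : ℕ, sInf S = n + 1 := ⟨(sInf S - 1).toNat, by omega⟩
  refine ⟨n, ?_, ?_, ?_⟩
  · rw [upperRG, ← hS, hn]
  · have : (n : ℤ) ∉ S := notMem_of_lt_csInf (by omega) hbdd
    simpa [S] using this
  · rw [hn] at hmem
    push_cast
    exact hmem

end Herbrand

section IndexPrime

variable {F E : Type*} [Field F] [Field E] [Algebra F E] [FiniteDimensional F E]
  {v : AddValuation E (WithTop ℤ)} {x : E} {p : ℕ}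

lemma card_filter_notMem {G : Type*} [Group G] [Finite G] [Fintype G] (A H : Subgroup G) [H.Normal]
    (hp : p.Prime) (hH : H.index = p) :
    (A ≤ H → (Finset.univ.filter fun σ => σ ∈ A ∧ σ ∉ H).card = 0) ∧
    (¬ A ≤ H → p * (Finset.univ.filter fun σ => σ ∈ A ∧ σ ∉ H).card = (p - 1) * Nat.card A ∧
      p * Nat.card (A ⊓ H : Subgroup G) = Nat.card A) := by
  have hsplit : Nat.card (A ⊓ H : Subgroup G) +
      (Finset.univ.filter fun σ => σ ∈ A ∧ σ ∉ H).card = Nat.card A := by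
    have h1 : Nat.card (A ⊓ H : Subgroup G) =
        ((Finset.univ.filter fun σ => σ ∈ A).filter fun σ => σ ∈ H).card := by
      rw [Nat.card_eq_fintype_card, Fintype.card_subtype, Finset.filter_filter]
      simp only [Subgroup.mem_inf]
    have h2 : (Finset.univ.filter fun σ => σ ∈ A ∧ σ ∉ H) =
        (Finset.univ.filter fun σ => σ ∈ A).filter fun σ => ¬ σ ∈ H := by
      rw [Finset.filter_filter]
    rw [h1, h2, Finset.card_filter_add_card_filter_not, Nat.card_eq_fintype_card,
      Fintype.card_subtype]
  constructor
  · intro hle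
    rw [Finset.card_eq_zero, Finset.filter_eq_empty_iff]
    exact fun σ _ h => h.2 (hle h.1)
  · intro hnle
    have hrel : H.relIndex A = p := by
      have hd := Subgroup.relIndex_dvd_index_of_normal H A
      rw [hH, Nat.dvd_prime hp, Subgroup.relIndex_eq_one] at hd
      exact hd.resolve_left hnle
    have hmul : p * Nat.card (A ⊓ H : Subgroup G) = Nat.card A := by
      have := Subgroup.relIndex_mul_relIndex ⊥ (H ⊓ A) A bot_le inf_le_right
      rwa [Subgroup.inf_relIndex_right, Subgroup.relIndex_bot_left, Subgroup.relIndex_bot_left,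
        hrel, mul_comm, inf_comm] at this
    refine ⟨?_, hmul⟩
    obtain ⟨q, rfl⟩ : ∃ q, p = q + 1 := ⟨p - 1, by have := hp.pos; omega⟩
    rw [Nat.add_sub_cancel]
    nlinarith

lemma IsDenseGenerator.sum_min_ramDepth (hx : IsDenseGenerator v x) (hG : GalInvariant F v)
    (H : Subgroup (E ≃ₐ[F] E)) (n : ℕ) :
    ∑ σ ∈ Finset.univ.filter (fun σ => σ ∉ H), min (ramDepth v x σ) n =
      ∑ j ∈ Finset.range n,
        ((Finset.univ.filter fun σ => σ ∈ lowerRG v hG j ∧ σ ∉ H).card : ℤ) := by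
  have h1 : ∀ j : ℕ, ((Finset.univ.filter fun σ => σ ∈ lowerRG v hG j ∧ σ ∉ H).card : ℤ) =
      ∑ σ ∈ Finset.univ.filter (fun σ => σ ∉ H), if (j : ℤ) < ramDepth v x σ then 1 else 0 := by
    intro j
    rw [Finset.sum_ite, Finset.sum_const_zero, add_zero, Finset.sum_const, nsmul_eq_mul, mul_one,
      Finset.filter_filter]
    congr 2
    refine Finset.filter_congr fun σ _ => ?_
    rw [and_comm]
    refine and_congr_right fun hσ => hx.mem_lowerRG_iff_lt_ramDepth hG ?_
    rintro rfl
    exact hσ H.one_mem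
  simp only [h1]
  rw [Finset.sum_comm]
  refine Finset.sum_congr rfl fun σ _ => ?_
  have h0 := hx.ramDepth_nonneg hG σ
  induction n with
  | zero => simpa using h0
  | succ n ih =>
    rw [Finset.sum_range_succ, ← ih]
    push_cast
    split_ifs <;> omega

/-- For a normal subgroup `H` of prime index, the size of the depths outside `H` detects whether
an upper ramification group is contained in `H`. -/
lemma IsDenseGenerator.sum_ramDepth_lt_iff (hx : IsDenseGenerator v x) (hG : GalInvariant F v)
    (H : Subgroup (E ≃ₐ[F] E)) [H.Normal] (hp : p.Prime) (hH : H.index = p) {ν : ℤ} (hν : 0 < ν) :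
    ∑ σ ∈ Finset.univ.filter (fun σ => σ ∉ H), ramDepth v x σ <
        ((p : ℤ) - 1) * (ν + 1) * Nat.card (lowerRG v hG 0 ⊓ H : Subgroup (E ≃ₐ[F] E)) ↔
      upperRG v hG ν ≤ H := by
  obtain ⟨n, hup, hlt, hle⟩ := exists_upperRG_eq_lowerRG hG hν
  rw [hup]
  set e := Nat.card (lowerRG v hG 0 ⊓ H : Subgroup (E ≃ₐ[F] E))
  have he : (0 : ℤ) < e := by exact_mod_cast Nat.card_pos
  have hp1 : (0 : ℤ) < (p : ℤ) - 1 := by have := hp.one_lt; omega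
  have hp0 : (0 : ℚ) < p := by exact_mod_cast hp.pos
  have hp1' : (0 : ℚ) < (p : ℚ) - 1 := by exact_mod_cast hp1
  have hcast : ((p - 1 : ℕ) : ℚ) = (p : ℚ) - 1 := by
    rw [Nat.cast_sub hp.one_lt.le, Nat.cast_one]
  set g := fun j : ℕ => Nat.card (lowerRG v hG j)
  set c := fun j : ℕ => (Finset.univ.filter fun σ => σ ∈ lowerRG v hG j ∧ σ ∉ H).card
  have hc := fun j : ℕ => card_filter_notMem (lowerRG v hG j) H hp hH
  have hg0 : (0 : ℚ) < g 0 := by exact_mod_cast Nat.card_pos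
  constructor
  · intro h
    by_contra hnle
    have hnle' : ∀ j ∈ Finset.range (n + 2), ¬ lowerRG v hG j ≤ H := fun j hj h' =>
      hnle ((lowerRG_antitone hG (by rw [Finset.mem_range] at hj; omega)).trans h')
    have h1 : ∑ j ∈ Finset.range (n + 2), (c j : ℤ) ≤
        ∑ σ ∈ Finset.univ.filter (fun σ => σ ∉ H), ramDepth v x σ := by
      rw [← hx.sum_min_ramDepth hG H]
      exact Finset.sum_le_sum fun σ _ => min_le_left _ _
    have h2 : (p : ℚ) * ∑ j ∈ Finset.range (n + 2), (c j : ℚ) =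
        ((p : ℚ) - 1) * (g 0 * (1 + herbrandPhi v hG ((n + 1 : ℕ) : ℤ))) := by
      have := card_mul_one_add_herbrandPhi hG (n + 1)
      rw [show (g 0 : ℚ) = (Nat.card (lowerRG v hG 0) : ℚ) from rfl, this, Finset.mul_sum,
        Finset.mul_sum]
      refine Finset.sum_congr rfl fun j hj => ?_
      rw [← hcast]
      exact_mod_cast ((hc j).2 (hnle' j hj)).1
    have h3 : (p : ℚ) * e = g 0 := by
      exact_mod_cast ((hc 0).2 (hnle' 0 (by simp))).2
    have h4 : (∑ j ∈ Finset.range (n + 2), (c j : ℚ)) < ((p : ℚ) - 1) * (ν + 1) * e := by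
      exact_mod_cast h1.trans_lt h
    have h5 : ((p : ℚ) - 1) * (ν + 1) * g 0 ≤
        ((p : ℚ) - 1) * (g 0 * (1 + herbrandPhi v hG ((n + 1 : ℕ) : ℤ))) := by
      rw [mul_assoc]
      refine mul_le_mul_of_nonneg_left ?_ hp1'.le
      rw [mul_comm]
      refine mul_le_mul_of_nonneg_left ?_ hg0.le
      linarith
    rw [← h2, ← h3] at h5
    have h6 := mul_lt_mul_of_pos_left h4 hp0
    linarith
  · intro hle'
    have h1 : ∑ σ ∈ Finset.univ.filter (fun σ => σ ∉ H), ramDepth v x σ =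
        ∑ j ∈ Finset.range (n + 1), (c j : ℤ) := by
      rw [← hx.sum_min_ramDepth hG H]
      refine Finset.sum_congr rfl fun σ hσ => ?_
      have hσH : σ ∉ H := (Finset.mem_filter.mp hσ).2
      have hσ1 : σ ≠ 1 := by rintro rfl; exact hσH H.one_mem
      have := mt (@hle' σ) hσH
      rw [hx.mem_lowerRG_iff_lt_ramDepth hG hσ1] at this
      push_cast
      omega
    rw [h1]
    by_cases h0 : lowerRG v hG 0 ≤ H
    · rw [Finset.sum_eq_zero]
      · exact mul_pos (mul_pos hp1 (by omega)) he
      · intro j _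
        exact_mod_cast (hc j).1 ((lowerRG_antitone hG (by omega)).trans h0)
    · have h3 : (p : ℚ) * e = g 0 := by
        exact_mod_cast ((hc 0).2 h0).2
      have h2 : (p : ℚ) * ∑ j ∈ Finset.range (n + 1), (c j : ℚ) ≤
          ((p : ℚ) - 1) * (g 0 * (1 + herbrandPhi v hG n)) := by
        rw [show (g 0 : ℚ) = (Nat.card (lowerRG v hG 0) : ℚ) from rfl,
          card_mul_one_add_herbrandPhi hG n, Finset.mul_sum, Finset.mul_sum]
        refine Finset.sum_le_sum fun j hj => ?_
        rw [← hcast]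
        by_cases hj' : lowerRG v hG j ≤ H
        · have := (hc j).1 hj'
          rw [show c j = 0 from this, Nat.cast_zero, mul_zero]
          positivity
        · exact_mod_cast ((hc j).2 hj').1.le
      have h5 : ((p : ℚ) - 1) * (g 0 * (1 + herbrandPhi v hG n)) <
          ((p : ℚ) - 1) * (g 0 * (1 + ν)) := by
        refine mul_lt_mul_of_pos_left (mul_lt_mul_of_pos_left ?_ hg0) hp1'
        linarith
      rw [← h3] at h2 h5
      have h6 : (p : ℚ) * ∑ j ∈ Finset.range (n + 1), (c j : ℚ) <
          p * (((p : ℚ) - 1) * (ν + 1) * e) := by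
        refine h2.trans_lt (h5.trans_eq ?_)
        ring
      exact_mod_cast lt_of_mul_lt_mul_left h6 hp0.le

end IndexPrime

section Main

variable {K E : Type*} [Field K] [Field E] [Algebra K E] [FiniteDimensional K E] [IsGalois K E]
  {vK : AddValuation K (WithTop ℤ)} {vE : AddValuation E (WithTop ℤ)} {eL eE p : ℕ}

lemma differentVal_lt_iff_upperRG_le (hvE : IsNormalized vE) (hE : Extends vK vE eE)
    (hG : GalInvariant K vE) [Finite (valRing vE ⧸ IsLocalRing.maximalIdeal (valRing vE))]
    (hp : p.Prime) (L : IntermediateField K E) [L.fixingSubgroup.Normal]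
    (hL : Module.finrank K L = p) {vL : AddValuation L (WithTop ℤ)} (hvL : IsNormalized vL)
    (hKL : Extends vK vL eL) {ν : ℤ} (hν : 0 < ν) :
    differentVal K vK vL < ((p : ℤ) - 1) * (ν + 1) ↔ upperRG vE hG ν ≤ L.fixingSubgroup := by
  obtain ⟨x, hx⟩ : ∃ x, IsDenseGenerator vE x := exists_dense_generator hvE
  obtain ⟨e, hLE⟩ := hKL.exists_extends_top hvL hE hG
  have hind : L.fixingSubgroup.index = p := by
    rw [← IntermediateField.finrank_eq_fixingSubgroup_index, hL]
  have hGL : GalInvariant L vE := hG.tower_top L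
  have hcard := card_lowerRG_zero hLE hGL hvL hvE
  let φ := L.fixingSubgroupEquiv
  have hcard' : Nat.card (lowerRG vE hG 0 ⊓ L.fixingSubgroup : Subgroup (E ≃ₐ[K] E)) = e := by
    rw [← hcard]
    refine Nat.card_congr
      { toFun := fun σ => ⟨φ ⟨σ, σ.2.2⟩, σ.2.1⟩
        invFun := fun σ => ⟨φ.symm σ, σ.2, (φ.symm σ).2⟩
        left_inv := fun σ => rfl
        right_inv := fun σ => rfl }
  have hsum : ∑ σ : E ≃ₐ[K] E, ramDepth vE x σ - ∑ σ : E ≃ₐ[L] E, ramDepth vE x σ =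
      ∑ σ ∈ Finset.univ.filter (fun σ => σ ∉ L.fixingSubgroup), ramDepth vE x σ := by
    have h1 : ∑ σ : E ≃ₐ[L] E, ramDepth vE x σ =
        ∑ σ ∈ Finset.univ.filter (fun σ => σ ∈ L.fixingSubgroup), ramDepth vE x σ := by
      rw [Finset.sum_subtype (p := fun σ => σ ∈ L.fixingSubgroup) _ (by simp)]
      exact (Equiv.sum_comp φ.toEquiv (ramDepth vE x)).symm
    rw [h1, ← Finset.sum_filter_add_sum_filter_not _ (fun σ => σ ∈ L.fixingSubgroup),
      add_sub_cancel_left]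
  rw [hx.differentVal_lt_iff hvL hvE hE hLE hG, hsum, ← hcard']
  exact hx.sum_ramDepth_lt_iff hG L.fixingSubgroup hp hind hν

lemma exists_dual_eq_zero_of_notMem {V : Type*} [AddCommGroup V] [Fact p.Prime]
    [Module (ZMod p) V] (U : AddSubgroup V) {s : V} (hs : s ∉ U) :
    ∃ f : V →+ ZMod p, f s ≠ 0 ∧ ∀ u ∈ U, f u = 0 := by
  obtain ⟨f, hfs, hfU⟩ := Submodule.exists_dual_map_eq_bot_of_notMem
    (p := AddSubgroup.toZModSubmodule p U) (x := s) hs inferInstance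
  refine ⟨f.toAddMonoidHom, hfs, fun u hu => ?_⟩
  have : f u ∈ Submodule.map f (AddSubgroup.toZModSubmodule p U) := Submodule.mem_map_of_mem hu
  rwa [hfU, Submodule.mem_bot] at this

lemma exists_index_eq_prime_of_notMem {G : Type*} [CommGroup G] [Fact p.Prime]
    (hexp : ∀ a : G, a ^ p = 1) (U : Subgroup G) {s : G} (hs : s ∉ U) :
    ∃ H : Subgroup G, H.index = p ∧ U ≤ H ∧ s ∉ H := by
  let _ : Module (ZMod p) (Additive G) := AddCommGroup.zmodModule fun x => hexp x.toMul
  obtain ⟨f, hfs, hfU⟩ := exists_dual_eq_zero_of_notMem (p := p) U.toAddSubgroup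
    (s := Additive.ofMul s) hs
  let f' : G →* Multiplicative (ZMod p) := AddMonoidHom.toMultiplicativeRight f
  have hf' : ∀ g, g ∈ f'.ker ↔ f (Additive.ofMul g) = 0 := fun g => Iff.rfl
  refine ⟨f'.ker, ?_, fun u hu => (hf' u).mpr (hfU _ hu), fun h => hfs ((hf' s).mp h)⟩
  have hcard : Nat.card (Multiplicative (ZMod p)) = p := by simp
  have : Fact (Nat.card (Multiplicative (ZMod p))).Prime := by rwa [hcard]
  have hsurj : f'.range = ⊤ := by
    refine f'.range.eq_bot_or_eq_top_of_prime_card.resolve_left fun h => hfs ((hf' s).mp ?_)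
    rw [MonoidHom.range_eq_bot_iff] at h
    rw [h]
    trivial
  rw [Subgroup.index_ker, hsurj, Subgroup.card_top, hcard]

theorem upperRG_eq_iInf_fixingSubgroup [Fact p.Prime] (hvK : IsNormalized vK)
    (hvE : IsNormalized vE) (hE : Extends vK vE eE) (hG : GalInvariant K vE)
    [Finite (valRing vE ⧸ IsLocalRing.maximalIdeal (valRing vE))]
    (hcomm : ∀ a b : E ≃ₐ[K] E, a * b = b * a) (hexp : ∀ a : E ≃ₐ[K] E, a ^ p = 1)
    {ν : ℤ} (hν : 0 < ν) :
    upperRG vE hG ν =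
      ⨅ L ∈ {L : IntermediateField K E | Module.finrank K L = p ∧
          ∃ (vL : AddValuation L (WithTop ℤ)) (eL : ℕ), IsNormalized vL ∧ Extends vK vL eL ∧
            differentVal K vK vL < ((p : ℤ) - 1) * (ν + 1)},
        L.fixingSubgroup := by
  have hp : p.Prime := Fact.out
  have hnormal : ∀ H : Subgroup (E ≃ₐ[K] E), H.Normal := fun H =>
    ⟨fun h hh g => by rwa [hcomm g h, mul_inv_cancel_right]⟩
  apply le_antisymm
  · refine le_iInf₂ fun L hL => ?_
    obtain ⟨hLp, vL, eL, hvL, hKL, hlt⟩ := hL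
    have := hnormal L.fixingSubgroup
    exact (differentVal_lt_iff_upperRG_le hvE hE hG hp L hLp hvL hKL hν).mp hlt
  · intro s hs
    by_contra hsU
    let _ : CommGroup (E ≃ₐ[K] E) := { mul_comm := hcomm }
    obtain ⟨H, hH, hUH, hsH⟩ := exists_index_eq_prime_of_notMem hexp _ hsU
    set L := IntermediateField.fixedField H
    have hLH : L.fixingSubgroup = H := IntermediateField.fixingSubgroup_fixedField H
    have := hnormal L.fixingSubgroup
    have hLp : Module.finrank K L = p := by
      rw [IntermediateField.finrank_eq_fixingSubgroup_index, hLH, hH]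
    obtain ⟨vL, eL, hvL, hKL⟩ := hE.exists_intermediate (L := L) hvK
    have hlt := (differentVal_lt_iff_upperRG_le hvE hE hG hp L hLp hvL hKL hν).mpr
      (hUH.trans_eq hLH.symm)
    have hsL := (iInf₂_le (f := fun (L : IntermediateField K E) _ => L.fixingSubgroup) L
      ⟨hLp, vL, eL, hvL, hKL, hlt⟩) hs
    rw [hLH] at hsL
    exact hsH hsL

end Main

section ElementaryAbelian

variable {K E : Type*} [Field K] [Field E] [Algebra K E] {p : ℕ}

lemma algEquiv_eq_one_of_restrictNormalHom
    (hgen : ⨆ M ∈ {M : IntermediateField K E | Module.finrank K M = p ∧ Normal K M}, M = ⊤)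
    {τ : E ≃ₐ[K] E}
    (hτ : ∀ (M : IntermediateField K E) (_ : Normal K M), Module.finrank K M = p →
      AlgEquiv.restrictNormalHom M τ = 1) : τ = 1 := by
  have h1 : ⨆ M ∈ {M : IntermediateField K E | Module.finrank K M = p ∧ Normal K M}, M ≤
      IntermediateField.fixedField (Subgroup.zpowers τ) := by
    refine iSup₂_le fun M hM => ?_
    obtain ⟨hMp, hMn⟩ := hM
    rw [IntermediateField.le_iff_le, Subgroup.zpowers_le]
    intro x
    have h2 := AlgEquiv.restrictNormal_commutes τ M x
    have h3 : AlgEquiv.restrictNormal τ M = 1 := hτ M hMn hMp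
    rw [h3] at h2
    exact h2.symm
  rw [hgen, top_le_iff] at h1
  ext x
  have h2 : x ∈ IntermediateField.fixedField (Subgroup.zpowers τ) := by
    rw [h1]; trivial
  exact h2 ⟨τ, Subgroup.mem_zpowers τ⟩

lemma card_algEquiv_of_finrank_prime [CharZero K] [Fact p.Prime] {M : IntermediateField K E}
    [Normal K M] (hM : Module.finrank K M = p) : Nat.card (M ≃ₐ[K] M) = p := by
  have : FiniteDimensional K M := Module.finite_of_finrank_pos (by
    rw [hM]; exact (Fact.out : p.Prime).pos)
  have : IsGalois K M := ⟨⟩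
  rw [IsGalois.card_aut_eq_finrank, hM]

lemma algEquiv_mul_comm_of_iSup_eq_top [CharZero K] [Fact p.Prime]
    (hgen : ⨆ M ∈ {M : IntermediateField K E | Module.finrank K M = p ∧ Normal K M}, M = ⊤)
    (a b : E ≃ₐ[K] E) : a * b = b * a := by
  rw [← commutatorElement_eq_one_iff_mul_comm]
  refine algEquiv_eq_one_of_restrictNormalHom hgen fun M hMn hM => ?_
  have : IsCyclic (M ≃ₐ[K] M) := isCyclic_of_prime_card (card_algEquiv_of_finrank_prime hM)
  rw [map_commutatorElement, commutatorElement_eq_one_iff_mul_comm]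
  exact IsCyclic.isMulCommutative.is_comm.comm _ _

lemma algEquiv_pow_eq_one_of_iSup_eq_top [CharZero K] [Fact p.Prime]
    (hgen : ⨆ M ∈ {M : IntermediateField K E | Module.finrank K M = p ∧ Normal K M}, M = ⊤)
    (a : E ≃ₐ[K] E) : a ^ p = 1 := by
  refine algEquiv_eq_one_of_restrictNormalHom hgen fun M hMn hM => ?_
  rw [map_pow, ← card_algEquiv_of_finrank_prime hM, pow_card_eq_one']

variable (p) (Ω : Type*) [Field Ω] [Algebra K Ω]

lemma normal_maxElemAbelian : Normal K (maxElemAbelian p K Ω) := by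
  let t : {L : IntermediateField K Ω | Module.finrank K L = p ∧ Normal K L} →
    IntermediateField K Ω := fun L => L.1
  have ht : ∀ L, Normal K (t L) := fun L => L.2.2
  have h : maxElemAbelian p K Ω = ⨆ L, t L := iSup_subtype'
  rw [h]
  exact IntermediateField.normal_iSup K Ω (t := t)

lemma iSup_eq_top_maxElemAbelian :
    ⨆ M ∈ {M : IntermediateField K (maxElemAbelian p K Ω) |
      Module.finrank K M = p ∧ Normal K M}, M = ⊤ := by
  set S := ⨆ M ∈ {M : IntermediateField K (maxElemAbelian p K Ω) |
      Module.finrank K M = p ∧ Normal K M}, M with hS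
  have hle : maxElemAbelian p K Ω ≤ IntermediateField.lift S := by
    refine iSup₂_le fun L hL x hx => ?_
    have hLE : L ≤ maxElemAbelian p K Ω := by
      unfold maxElemAbelian
      exact le_iSup₂ (f := fun (L : IntermediateField K Ω)
        (_ : L ∈ {L : IntermediateField K Ω | Module.finrank K L = p ∧ Normal K L}) => L) L hL
    have hmem : IntermediateField.restrict hLE ∈ {M : IntermediateField K (maxElemAbelian p K Ω) |
        Module.finrank K M = p ∧ Normal K M} := by
      let φ := IntermediateField.restrictAlgEquiv hLE
      have := hL.2
      exact ⟨φ.toLinearEquiv.finrank_eq.symm.trans hL.1, Normal.of_algEquiv φ⟩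
    have hxS : (⟨x, hLE hx⟩ : maxElemAbelian p K Ω) ∈ S := by
      refine (le_iSup₂ (f := fun (M : IntermediateField K (maxElemAbelian p K Ω))
        (_ : M ∈ {M : IntermediateField K (maxElemAbelian p K Ω) |
          Module.finrank K M = p ∧ Normal K M}) => M) _ hmem) ?_
      rw [IntermediateField.mem_restrict]
      exact hx
    exact (IntermediateField.mem_lift (⟨x, hLE hx⟩ : maxElemAbelian p K Ω)).mpr hxS
  rw [eq_top_iff]
  intro y _
  exact (IntermediateField.mem_lift y).mp (hle y.2)

end ElementaryAbelian

lemma IsPadicValuation.of_extends {p : ℕ} [Fact p.Prime] {K E : Type*} [Field K] [Field E]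
    [Algebra ℚ_[p] K] [Algebra K E] [Algebra ℚ_[p] E] [IsScalarTower ℚ_[p] K E]
    {vK : AddValuation K (WithTop ℤ)} {vE : AddValuation E (WithTop ℤ)} {eK e : ℕ}
    (hK : IsPadicValuation p vK eK) (hvE : IsNormalized vE) (h : Extends vK vE e) :
    IsPadicValuation p vE (e * eK) := by
  refine ⟨hvE, Nat.mul_pos h.1 hK.2.1, fun x hx => ?_⟩
  rw [IsScalarTower.algebraMap_apply ℚ_[p] K E, h.val_eq (hK.2.2 x hx)]
  push_cast
  rw [mul_assoc]

/-- For `G = Gal(𝒞_K(p)/K)` and every `ν > 0`,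
`G^ν = ⋂ Gal(𝒞_K(p)/L)`, the intersection being over the degree-`p` subextensions
`L/K` of `𝒞_K(p)` with `v_L(𝒟_{L/K})/(p-1) < ν + 1`. -/
theorem statement_17
    (p : ℕ) [Fact p.Prime]
    (K : Type*) [Field K] [Algebra ℚ_[p] K] [FiniteDimensional ℚ_[p] K]
    (vK : AddValuation K (WithTop ℤ)) (eK : ℕ)
    (hvK : IsPadicValuation p vK eK)
    (Ω : Type*) [Field Ω] [Algebra K Ω] [IsAlgClosure K Ω]
    [FiniteDimensional K ↥(maxElemAbelian p K Ω)]
    (vC : AddValuation ↥(maxElemAbelian p K Ω) (WithTop ℤ)) (eC : ℕ)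
    (hvC : IsNormalized vC) (hext : Extends vK vC eC)
    (hGal : GalInvariant K vC)
    (ν : ℤ) (hν : 0 < ν) :
    upperRG vC hGal ν =
      ⨅ L ∈ {L : IntermediateField K ↥(maxElemAbelian p K Ω) |
          Module.finrank K ↥L = p ∧
          ∃ (vL : AddValuation ↥L (WithTop ℤ)) (eL : ℕ),
            IsNormalized vL ∧ Extends vK vL eL ∧
            differentVal K vK vL < ((p : ℤ) - 1) * (ν + 1)},
        L.fixingSubgroup := by
  let _ : Algebra ℚ_[p] (maxElemAbelian p K Ω) :=
    ((algebraMap K (maxElemAbelian p K Ω)).comp (algebraMap ℚ_[p] K)).toAlgebra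
  have : IsScalarTower ℚ_[p] K (maxElemAbelian p K Ω) := .of_algebraMap_eq fun _ => rfl
  have : FiniteDimensional ℚ_[p] (maxElemAbelian p K Ω) := FiniteDimensional.trans ℚ_[p] K _
  have : CharZero K := charZero_of_injective_algebraMap (algebraMap ℚ_[p] K).injective
  have : Normal K (maxElemAbelian p K Ω) := normal_maxElemAbelian p Ω
  have : IsGalois K (maxElemAbelian p K Ω) := ⟨⟩
  have := (hvK.of_extends hvC hext).finite_residueField
  have hgen := iSup_eq_top_maxElemAbelian (K := K) p Ω
  exact upperRG_eq_iInf_fixingSubgroup hvK.1 hvC hext hGal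
    (algEquiv_mul_comm_of_iSup_eq_top hgen) (algEquiv_pow_eq_one_of_iSup_eq_top hgen) hν
end PaperRam
end
end

section
/- (Fesenko–Vostokov) Assume ζ_p ∉ K. Then every α ∈ U_K^1 can be written uniquely as a convergent product α = ∏_{i ∈ I} ∏_{j=1}^{f_K} (1 + c_j π^i)^{a_{ij}} with exponents a_{ij} ∈ ℤ_p; in particular, U_K^1 is a free ℤ_p-module of rank n_K = [K : ℚ_p] with topological basis {1 + c_j π^i : i ∈ I, 1 ≤ j ≤ f_K}. -/
noncomputable section

open scoped Classical

namespace PaperRam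

variable {K F : Type*} [Field K] [Field F] [Algebra K F]

/-- The index `λ(n)` such that the `p`-th power map sends `1 + π ^ n` to level `λ(n)`. -/
def powLevel (p e n : ℕ) : ℕ := min (p * n) (n + e)

/-- The levels of principal units that are not reached by `p`-th powers. -/
abbrev freeLevels (p e : ℕ) : Set ℕ := {i : ℕ | 1 ≤ i ∧ (p - 1) * i < p * e ∧ Nat.Coprime i p}

section Levels

variable {p e n : ℕ}

lemma powLevel_of_lt (h : p * n < n + e) : powLevel p e n = p * n := min_eq_left h.le

lemma powLevel_of_ge (h : n + e ≤ p * n) : powLevel p e n = n + e := min_eq_right h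

lemma powLevel_strictMono (hp : p.Prime) : StrictMono (powLevel p e) := by
  intro a b hab
  have h1 : p * a < p * b := Nat.mul_lt_mul_of_pos_left hab hp.pos
  unfold powLevel
  omega

lemma lt_powLevel (hp : p.Prime) (he : 0 < e) (hn : 1 ≤ n) : n < powLevel p e n := by
  have h1 : 2 * n ≤ p * n := Nat.mul_le_mul_right _ hp.two_le
  unfold powLevel
  omega

lemma powLevel_notMem_freeLevels (hp : p.Prime) : powLevel p e n ∉ freeLevels p e := by
  rintro ⟨-, h2, h3⟩
  rcases lt_or_ge (p * n) (n + e) with h | h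
  · rw [powLevel_of_lt h] at h3
    exact hp.one_lt.ne' (Nat.Coprime.eq_one_of_dvd (h3.symm) (dvd_mul_right p n))
  · rw [powLevel_of_ge h] at h2
    obtain ⟨q, rfl⟩ : ∃ q, p = q + 1 := ⟨p - 1, by have := hp.pos; omega⟩
    simp only [Nat.add_sub_cancel] at h2
    nlinarith

lemma exists_powLevel_eq (hp : p.Prime) {m : ℕ} (hm : 1 ≤ m) (hI : m ∉ freeLevels p e) :
    ∃ n, 1 ≤ n ∧ powLevel p e n = m := by
  obtain ⟨q, rfl⟩ : ∃ q, p = q + 1 := ⟨p - 1, by have := hp.pos; omega⟩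
  have hq : 1 ≤ q := by have := hp.two_le; omega
  by_cases h : (q + 1 - 1) * m < (q + 1) * e
  · have hd : (q + 1) ∣ m := by
      by_contra hd
      exact hI ⟨hm, h, ((Nat.Prime.coprime_iff_not_dvd hp).2 hd).symm⟩
    obtain ⟨n, rfl⟩ := hd
    refine ⟨n, Nat.pos_of_ne_zero (by rintro rfl; simp at hm), powLevel_of_lt ?_⟩
    simp only [Nat.add_sub_cancel] at h
    have : q * n < e := by
      by_contra! h'
      nlinarith
    nlinarith
  · simp only [Nat.add_sub_cancel, not_lt] at h
    have hem : e ≤ m := by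
      by_contra! h'
      nlinarith
    obtain ⟨n, rfl⟩ := Nat.exists_eq_add_of_le' hem
    have hn : e ≤ q * n := by nlinarith
    refine ⟨n, Nat.pos_of_ne_zero ?_, powLevel_of_ge (by nlinarith)⟩
    rintro rfl
    omega

lemma freeLevels_subset (hp : p.Prime) : freeLevels p e ⊆ Finset.Icc 1 (2 * e) := by
  rintro i ⟨h1, h2, -⟩
  obtain ⟨q, rfl⟩ : ∃ q, p = q + 1 := ⟨p - 1, by have := hp.pos; omega⟩
  have hq : 1 ≤ q := by have := hp.two_le; omega
  simp only [Nat.add_sub_cancel] at h2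
  simp only [Finset.coe_Icc, Set.mem_Icc]
  refine ⟨h1, ?_⟩
  by_contra! h'
  nlinarith

lemma freeLevels_finite (hp : p.Prime) : (freeLevels p e).Finite :=
  (Finset.finite_toSet _).subset (freeLevels_subset hp)

lemma card_freeLevels (hp : p.Prime) : Nat.card (freeLevels p e) = e := by
  have hpow : powLevel p e e = 2 * e := by
    rw [powLevel_of_ge, two_mul]
    have := Nat.mul_le_mul_right e hp.two_le
    omega
  have hunion : freeLevels p e ∪ powLevel p e '' (Finset.Icc 1 e : Finset ℕ) =
      (Finset.Icc 1 (2 * e) : Finset ℕ) := by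
    apply Set.Subset.antisymm
    · refine Set.union_subset (freeLevels_subset hp) ?_
      rintro _ ⟨n, hn, rfl⟩
      simp only [Finset.coe_Icc, Set.mem_Icc] at hn ⊢
      have h1 := (powLevel_strictMono (e := e) hp).le_iff_le.2 hn.2
      have h2 := lt_powLevel hp (lt_of_lt_of_le hn.1 hn.2) hn.1
      omega
    · intro m hm
      simp only [Finset.coe_Icc, Set.mem_Icc] at hm
      by_cases hI : m ∈ freeLevels p e
      · exact Or.inl hI
      · obtain ⟨n, hn, rfl⟩ := exists_powLevel_eq hp hm.1 hI
        refine Or.inr ⟨n, ?_, rfl⟩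
        rw [← hpow] at hm
        simpa using ⟨hn, (powLevel_strictMono hp).le_iff_le.1 hm.2⟩
  have hdisj : Disjoint (freeLevels p e) (powLevel p e '' (Finset.Icc 1 e : Finset ℕ)) := by
    rw [Set.disjoint_left]
    rintro _ h ⟨n, -, rfl⟩
    exact powLevel_notMem_freeLevels hp h
  have h := Set.ncard_union_eq hdisj (freeLevels_finite hp) (Set.toFinite _)
  rw [hunion, Set.ncard_image_of_injective _ (powLevel_strictMono hp).injective,
    Set.ncard_coe_finset, Set.ncard_coe_finset, Nat.card_Icc, Nat.card_Icc] at h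
  rw [Nat.card_coe_set_eq]
  omega

end Levels

section Algebra

variable {O : Type*} [CommRing O]

lemma exists_one_add_pow_prime_eq {p : ℕ} (hp : p.Prime) (t : O) :
    ∃ w, (1 + t) ^ p = 1 + t ^ p + p * t * (1 + t * w) := by
  have h1 : 1 ∈ Finset.Ioo 0 p := Finset.mem_Ioo.2 ⟨one_pos, hp.one_lt⟩
  have hd : t ∣ ∑ k ∈ (Finset.Ioo 0 p).erase 1,
      t ^ (k - 1) * 1 ^ (p - k - 1) * ((p.choose k / p : ℕ) : O) := by
    refine Finset.dvd_sum fun k hk => ?_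
    simp only [Finset.mem_erase, Finset.mem_Ioo] at hk
    exact ((dvd_pow_self t (by omega)).mul_right _).mul_right _
  obtain ⟨w, hw⟩ := hd
  refine ⟨w, ?_⟩
  rw [add_comm 1 t, add_pow_prime_eq hp, ← Finset.add_sum_erase _ _ h1, hw]
  simp [Nat.div_self hp.pos]
  ring

/-- `π` is a uniformizer of a local domain with finite residue field in which `p` has
valuation `e`. -/
structure IsMixedUniformizer (p e : ℕ) (π : O) : Prop where
  prime : Prime π
  exists_eq : ∃ u, (p : O) = π ^ e * u ∧ ¬π ∣ u
  isUnit : ∀ x, π ∣ x - 1 → IsUnit x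
  finite : Finite (O ⧸ Ideal.span {π})

section Congruence

variable {π x y a b : O} {n : ℕ}

lemma dvd_mul_sub_one (hx : π ∣ x - 1) (hy : π ∣ y - 1) : π ∣ x * y - 1 := by
  have : x * y - 1 = (x - 1) * y + (y - 1) := by ring
  exact this ▸ dvd_add (hx.mul_right _) hy

lemma not_dvd_of_dvd_sub_one (hπ : Prime π) (hx : π ∣ x - 1) : ¬π ∣ x := fun h =>
  hπ.not_isUnit (isUnit_of_dvd_one (by simpa using dvd_sub h hx))

lemma dvd_sub_one_of_congr (hx : π ^ (n + 1) ∣ x - (1 + π ^ n * a)) : π ^ n ∣ x - 1 := by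
  have : x - 1 = (x - (1 + π ^ n * a)) + π ^ n * a := by ring
  rw [this]
  exact dvd_add ((pow_dvd_pow π n.le_succ).trans hx) (dvd_mul_right _ _)

lemma dvd_mul_sub_one_add (hn : 1 ≤ n) (hx : π ^ (n + 1) ∣ x - (1 + π ^ n * a))
    (hy : π ^ (n + 1) ∣ y - (1 + π ^ n * b)) :
    π ^ (n + 1) ∣ x * y - (1 + π ^ n * (a + b)) := by
  have h : π ^ (n + 1) ∣ π ^ n * π ^ n := by
    rw [← pow_add]; exact pow_dvd_pow _ (by omega)
  have : x * y - (1 + π ^ n * (a + b)) = (x - (1 + π ^ n * a)) * y +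
    (1 + π ^ n * a) * (y - (1 + π ^ n * b)) + π ^ n * π ^ n * (a * b) := by ring
  rw [this]
  exact dvd_add (dvd_add (hx.mul_right _) (hy.mul_left _)) (h.mul_right _)

lemma dvd_pow_sub_one_add (hn : 1 ≤ n) (hx : π ^ (n + 1) ∣ x - (1 + π ^ n * a)) (k : ℕ) :
    π ^ (n + 1) ∣ x ^ k - (1 + π ^ n * (k * a)) := by
  induction k with
  | zero => simp
  | succ k ih =>
    rw [pow_succ x, Nat.cast_succ, add_one_mul]
    exact dvd_mul_sub_one_add hn ih hx

lemma dvd_prod_sub_one_add {ι : Type*} (hn : 1 ≤ n) (s : Finset ι) (x a : ι → O)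
    (h : ∀ i ∈ s, π ^ (n + 1) ∣ x i - (1 + π ^ n * a i)) :
    π ^ (n + 1) ∣ ∏ i ∈ s, x i - (1 + π ^ n * ∑ i ∈ s, a i) := by
  induction s using Finset.induction_on with
  | empty => simp
  | insert i s hi ih =>
    rw [Finset.prod_insert hi, Finset.sum_insert hi]
    exact dvd_mul_sub_one_add hn (h i (Finset.mem_insert_self i s))
      (ih fun j hj => h j (Finset.mem_insert_of_mem hj))

end Congruence

namespace IsMixedUniformizer

variable {p e n : ℕ} {π x y : O}

lemma pow_dvd_pow_sub_one (h : IsMixedUniformizer p e π) (hp : p.Prime)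
    (hx : π ^ n ∣ x - 1) : π ^ powLevel p e n ∣ x ^ p - 1 := by
  obtain ⟨s, hs⟩ := hx
  obtain rfl : x = 1 + π ^ n * s := by rw [← hs]; ring
  obtain ⟨w, hw⟩ := exists_one_add_pow_prime_eq hp (π ^ n * s)
  obtain ⟨u, hu, -⟩ := h.exists_eq
  have h1 : π ^ powLevel p e n ∣ π ^ (p * n) := pow_dvd_pow _ (min_le_left _ _)
  have h2 : π ^ powLevel p e n ∣ π ^ (n + e) := pow_dvd_pow _ (min_le_right _ _)
  have : (1 + π ^ n * s) ^ p - 1 = π ^ (p * n) * s ^ p +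
      π ^ (n + e) * (u * s * (1 + π ^ n * s * w)) := by
    rw [hw, hu, mul_pow, ← pow_mul, mul_comm n p]; ring
  rw [this]
  exact dvd_add (h1.mul_right _) (h2.mul_right _)

variable [IsDomain O]

lemma dvd_sub_one_of_ne (h : IsMixedUniformizer p e π) (hp : p.Prime) (hn : 1 ≤ n)
    (hne : p * n ≠ n + e) (hx : π ^ n ∣ x - 1) (hxp : π ^ (powLevel p e n + 1) ∣ x ^ p - 1) :
    π ^ (n + 1) ∣ x - 1 := by
  obtain ⟨s, hs⟩ := hx
  rw [hs, pow_succ]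
  refine mul_dvd_mul_left _ ?_
  obtain rfl : x = 1 + π ^ n * s := by rw [← hs]; ring
  obtain ⟨w, hw⟩ := exists_one_add_pow_prime_eq hp (π ^ n * s)
  obtain ⟨u, hu, hpu⟩ := h.exists_eq
  have hexp : (1 + π ^ n * s) ^ p - 1 = π ^ (p * n) * s ^ p +
      π ^ (n + e) * (u * s * (1 + π ^ n * s * w)) := by
    rw [hw, hu, mul_pow, ← pow_mul, mul_comm n p]; ring
  rw [hexp] at hxp
  rcases lt_or_gt_of_ne hne with hlt | hgt
  · obtain ⟨k, hk⟩ := Nat.exists_eq_add_of_lt hlt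
    rw [powLevel_of_lt hlt, hk, show p * n + k + 1 = p * n + (k + 1) by ring,
      pow_add π _ (k + 1), mul_assoc, ← mul_add, pow_succ,
      mul_dvd_mul_iff_left (pow_ne_zero _ h.prime.ne_zero)] at hxp
    have h2 : π ∣ π ^ (k + 1) * (u * s * (1 + π ^ n * s * w)) :=
      (dvd_pow_self π k.succ_ne_zero).mul_right _
    exact h.prime.dvd_of_dvd_pow ((dvd_add_left h2).1 hxp)
  · obtain ⟨k, hk⟩ := Nat.exists_eq_add_of_lt hgt
    rw [powLevel_of_ge hgt.le, hk, show n + e + k + 1 = n + e + (k + 1) by ring,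
      pow_add π _ (k + 1), mul_assoc, ← mul_add, pow_succ,
      mul_dvd_mul_iff_left (pow_ne_zero _ h.prime.ne_zero)] at hxp
    have h2 : π ∣ π ^ (k + 1) * s ^ p := (dvd_pow_self π k.succ_ne_zero).mul_right _
    have h3 := (dvd_add_right h2).1 hxp
    have h4 : ¬π ∣ 1 + π ^ n * s * w := by
      refine not_dvd_of_dvd_sub_one h.prime ?_
      rw [add_sub_cancel_left]
      exact ((dvd_pow_self π (by omega)).mul_right _).mul_right _
    rcases h.prime.dvd_or_dvd h3 with h5 | h5
    · exact (h.prime.dvd_or_dvd h5).resolve_left hpu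
    · exact absurd h5 h4

/-- If the `p`-th power map is injective on the graded piece of level `n`, it is surjective. -/
lemma exists_pow_congr_of_injective (h : IsMixedUniformizer p e π) (hp : p.Prime) (hn : 1 ≤ n)
    (hinj : ∀ x : O, π ^ n ∣ x - 1 → π ^ (powLevel p e n + 1) ∣ x ^ p - 1 → π ^ (n + 1) ∣ x - 1)
    (hy : π ^ powLevel p e n ∣ y - 1) :
    ∃ x, π ^ n ∣ x - 1 ∧ π ^ (powLevel p e n + 1) ∣ y - x ^ p := by
  have hfin := h.finite
  have hdvd : ∀ s : O, π ^ n ∣ (1 + π ^ n * s) - 1 := fun s => by simp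
  choose t ht using fun s : O => h.pow_dvd_pow_sub_one hp (hdvd s)
  have hmk : ∀ a b : O, Ideal.Quotient.mk (Ideal.span {π}) a = Ideal.Quotient.mk _ b ↔
      π ∣ a - b := fun a b => by
    rw [Ideal.Quotient.eq, Ideal.mem_span_singleton]
  let g : O ⧸ Ideal.span {π} → O ⧸ Ideal.span {π} := fun s => Ideal.Quotient.mk _ (t s.out)
  have hg : Function.Injective g := by
    intro a b hab
    have h1 : π ∣ t a.out - t b.out := (hmk _ _).1 hab
    rw [← Quotient.out_eq a, ← Quotient.out_eq b]
    refine (hmk _ _).2 ?_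
    obtain ⟨z, hz⟩ := (h.isUnit (1 + π ^ n * b.out) (by
      rw [add_sub_cancel_left]; exact (dvd_pow_self π (by omega)).mul_right _)).dvd
        (a := 1 + π ^ n * a.out)
    have hzn : IsUnit (1 + π ^ n * b.out) := h.isUnit _ (by
      rw [add_sub_cancel_left]; exact (dvd_pow_self π (by omega)).mul_right _)
    have e1 : (1 + π ^ n * b.out) * (z - 1) = π ^ n * (a.out - b.out) := by
      linear_combination -hz
    have hz1 : π ^ n ∣ z - 1 := by
      rw [← hzn.dvd_mul_left, e1]; exact dvd_mul_right _ _
    have e2 : (1 + π ^ n * b.out) ^ p * (z ^ p - 1) =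
        π ^ powLevel p e n * (t a.out - t b.out) := by
      have h3 := ht a.out
      rw [hz, mul_pow] at h3
      linear_combination h3 - ht b.out
    have hz2 := hinj z hz1 (by
      rw [← (hzn.pow p).dvd_mul_left, e2, pow_succ]
      exact mul_dvd_mul_left _ h1)
    rw [← hzn.dvd_mul_left, e1, pow_succ,
      mul_dvd_mul_iff_left (pow_ne_zero _ h.prime.ne_zero)] at hz2
    exact hz2
  obtain ⟨r, hr⟩ := hy
  obtain ⟨s, hs⟩ := Finite.injective_iff_surjective.1 hg (Ideal.Quotient.mk _ r)
  refine ⟨1 + π ^ n * s.out, hdvd _, ?_⟩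
  have h1 : π ∣ r - t s.out := (hmk _ _).1 hs.symm
  have : y - (1 + π ^ n * s.out) ^ p = π ^ powLevel p e n * (r - t s.out) := by
    linear_combination hr - ht s.out
  rw [this, pow_succ]
  exact mul_dvd_mul_left _ h1

end IsMixedUniformizer

end Algebra

section Characters

variable {O : Type*} [CommRing O] {p : ℕ} [Fact p.Prime]

lemma addChar_natCast (χ : AddChar ℤ_[p] O) (n : ℕ) : χ (n : ℤ_[p]) = χ 1 ^ n := by
  rw [← AddChar.map_nsmul_eq_pow, nsmul_one]

/-- The product `a ↦ ∏ χ_i(a_i)` of a finite family of additive characters. -/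
def charProd {ι : Type*} [Fintype ι] (χ : ι → AddChar ℤ_[p] O) : AddChar (ι → ℤ_[p]) O where
  toFun a := ∏ i, χ i (a i)
  map_zero_eq_one' := by simp
  map_add_eq_mul' a b := by simp [AddChar.map_add_eq_mul, Finset.prod_mul_distrib]

variable {ι : Type*} [Fintype ι] {χ : ι → AddChar ℤ_[p] O}

lemma charProd_apply (a : ι → ℤ_[p]) : charProd χ a = ∏ i, χ i (a i) := rfl

lemma charProd_single [DecidableEq ι] (i : ι) (a : ℤ_[p]) :
    charProd χ (Pi.single i a) = χ i a := by
  rw [charProd_apply, Finset.prod_eq_single i]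
  · simp
  · intro j _ hj
    simp [Pi.single_eq_of_ne hj]
  · simp

lemma continuous_charProd [TopologicalSpace O] [IsTopologicalRing O]
    (hχ : ∀ i, Continuous (χ i)) : Continuous (charProd χ) :=
  continuous_finsetProd _ fun i _ => (hχ i).comp (continuous_apply i)

section FreeLevels

variable {e f : ℕ} {π : O} {c : Fin f → O} [Fintype (freeLevels p e)]
  {χ : freeLevels p e × Fin f → AddChar ℤ_[p] O}

lemma charProd_natCast_congr (hχ1 : ∀ i j, χ (i, j) 1 = 1 + c j * π ^ (i : ℕ))
    (i₀ : freeLevels p e) (m : freeLevels p e × Fin f → ℕ)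
    (hm : ∀ i j, i < i₀ → m (i, j) = 0) :
    π ^ ((i₀ : ℕ) + 1) ∣ charProd χ (fun k => (m k : ℤ_[p])) -
      (1 + π ^ (i₀ : ℕ) * ∑ j, (m (i₀, j) : O) * c j) := by
  have hsum : ∑ j, (m (i₀, j) : O) * c j =
      ∑ k : freeLevels p e × Fin f, if k.1 = i₀ then (m k : O) * c k.2 else 0 := by
    rw [Fintype.sum_prod_type, Finset.sum_comm]
    simp
  rw [hsum, charProd_apply]
  refine dvd_prod_sub_one_add i₀.2.1 _ _ _ fun ⟨i, j⟩ _ => ?_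
  rw [addChar_natCast, hχ1]
  dsimp only
  split_ifs with hi
  · subst hi
    refine dvd_pow_sub_one_add i.2.1 ?_ _
    rw [mul_comm, sub_self]
    exact dvd_zero _
  · rcases lt_or_ge i i₀ with hlt | hge
    · simp [hm i j hlt]
    · have hlt : (i₀ : ℕ) + 1 ≤ i :=
        show i₀ < i from lt_of_le_of_ne hge (Ne.symm hi)
      rw [mul_zero, add_zero]
      refine dvd_trans ?_ (sub_one_dvd_pow_sub_one _ _)
      rw [add_sub_cancel_left]
      exact (pow_dvd_pow π hlt).mul_left _

end FreeLevels

end Characters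

section Topology

variable {O : Type*} [CommRing O] [TopologicalSpace O]

/-- Closed sets for the topology of `O` are closed for the `π`-adic topology. -/
def ClosedContainsAdicLimits (π : O) : Prop :=
  ∀ S : Set O, IsClosed S → ∀ y, (∀ n : ℕ, ∃ h ∈ S, π ^ n ∣ y - h) → y ∈ S

/-- Successive approximation: a closed multiplicative set which approximates all principal units
of level `n ≥ n₀` contains all principal units of level `n₀`. -/
lemma mem_of_approximation {π : O} (hcl : ClosedContainsAdicLimits π)
    (hunit : ∀ x, π ∣ x - 1 → IsUnit x) {S : Set O} (hS : IsClosed S) (hone : 1 ∈ S)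
    (hmul : ∀ a ∈ S, ∀ b ∈ S, a * b ∈ S) {n₀ : ℕ} (hn₀ : 1 ≤ n₀)
    (happ : ∀ n, n₀ ≤ n → ∀ y, π ^ n ∣ y - 1 → ∃ h ∈ S, π ^ n ∣ h - 1 ∧ π ^ (n + 1) ∣ y - h)
    {y : O} (hy : π ^ n₀ ∣ y - 1) : y ∈ S := by
  have key : ∀ N : ℕ, ∃ h ∈ S, π ∣ h - 1 ∧ π ^ (n₀ + N) ∣ y - h := by
    intro N
    induction N with
    | zero => exact ⟨1, hone, by simp, hy⟩
    | succ N ih =>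
      obtain ⟨h, hhS, hh1, hyh⟩ := ih
      have hu := hunit h hh1
      obtain ⟨z, rfl⟩ := hu.dvd (a := y)
      have hz : π ^ (n₀ + N) ∣ z - 1 := by
        rw [← hu.dvd_mul_left, mul_sub, mul_one]; exact hyh
      obtain ⟨h', hS', h1', hz'⟩ := happ (n₀ + N) (Nat.le_add_right _ _) z hz
      refine ⟨h * h', hmul h hhS h' hS', dvd_mul_sub_one hh1
        ((dvd_pow_self π (by omega)).trans h1'), ?_⟩
      rw [← mul_sub]
      exact hz'.mul_left h
  refine hcl S hS y fun n => ?_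
  obtain ⟨h, hhS, -, hyh⟩ := key n
  exact ⟨h, hhS, (pow_dvd_pow π (Nat.le_add_left _ _)).trans hyh⟩

variable [IsTopologicalRing O] [CompactSpace O] [T2Space O]

lemma isClosed_setOf_dvd_sub (d a : O) : IsClosed {z : O | d ∣ z - a} := by
  have : {z : O | d ∣ z - a} = Set.range fun t => a + d * t := by
    ext z
    simp only [Set.mem_ofPred_eq, Set.mem_range, dvd_def]
    exact exists_congr fun t => by rw [sub_eq_iff_eq_add', eq_comm]
  rw [this]
  exact (isCompact_range (by fun_prop)).isClosed

/-- Without `p`-torsion, the `p`-th power map is injective on the graded pieces of the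
filtration of principal units. -/
lemma IsMixedUniformizer.dvd_sub_one_of_pow [IsDomain O] {p e n : ℕ} {π x : O}
    (h : IsMixedUniformizer p e π) (hcl : ClosedContainsAdicLimits π) (hp : p.Prime)
    (htors : ∀ z : O, z ^ p = 1 → z = 1) (hn : 1 ≤ n) (hx : π ^ n ∣ x - 1)
    (hxp : π ^ (powLevel p e n + 1) ∣ x ^ p - 1) : π ^ (n + 1) ∣ x - 1 := by
  by_cases hne : p * n = n + e
  swap
  · exact h.dvd_sub_one_of_ne hp hn hne hx hxp
  rw [powLevel_of_ge hne.ge] at hxp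
  have hmem : x ^ p ∈ (fun z => z ^ p) '' {z : O | π ^ (n + 1) ∣ z - 1} := by
    refine mem_of_approximation hcl h.isUnit (n₀ := n + e + 1)
      ((isClosed_setOf_dvd_sub _ _).isCompact.image (continuous_pow p)).isClosed
      ⟨1, by simp, one_pow p⟩ ?_ (by omega) ?_ hxp
    · rintro _ ⟨a, ha, rfl⟩ _ ⟨b, hb, rfl⟩
      exact ⟨a * b, dvd_mul_sub_one ha hb, mul_pow a b p⟩
    · intro m hm y hy
      obtain ⟨k, rfl⟩ : ∃ k, m = n + 1 + k + e := ⟨m - (n + 1 + e), by omega⟩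
      have hlt : n + 1 + k + e < p * (n + 1 + k) := by
        have := Nat.mul_le_mul_right (1 + k) hp.two_le
        nlinarith
      have hpl : powLevel p e (n + 1 + k) = n + 1 + k + e := powLevel_of_ge hlt.le
      rw [← hpl] at hy
      obtain ⟨z, hz, hyz⟩ := h.exists_pow_congr_of_injective hp (by omega)
        (fun w hw hwp => h.dvd_sub_one_of_ne hp (by omega) hlt.ne' hw hwp) hy
      refine ⟨z ^ p, ⟨z, (pow_dvd_pow π (by omega)).trans hz, rfl⟩, ?_, ?_⟩
      · rw [← hpl]; exact h.pow_dvd_pow_sub_one hp hz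
      · rw [← hpl]; exact hyz
  obtain ⟨z, hz, hzx⟩ := hmem
  have hzu : IsUnit z := h.isUnit z ((dvd_pow_self π n.succ_ne_zero).trans hz)
  obtain ⟨q, rfl⟩ := hzu.dvd (a := x)
  have hq : q ^ p = 1 := by
    refine (hzu.pow p).mul_left_cancel ?_
    rw [mul_one, ← mul_pow]
    exact hzx.symm
  rw [htors q hq, mul_one]
  exact hz

/-- The `p`-th power of a principal unit never lies exactly on a free level. -/
lemma dvd_of_pow_dvd_pow_sub_one [IsDomain O] {p e : ℕ} [Fact p.Prime] {π : O}
    (h : IsMixedUniformizer p e π) (hcl : ClosedContainsAdicLimits π) (htors : ∀ z : O, z ^ p = 1 → z = 1)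
    {i : ℕ} (hi : i ∈ freeLevels p e) {x : O} (hx : π ∣ x - 1) (hxp : π ^ i ∣ x ^ p - 1) :
    π ^ (i + 1) ∣ x ^ p - 1 := by
  have hp : p.Prime := Fact.out
  have key : ∀ n, 1 ≤ n → π ^ n ∣ x - 1 ∨ π ^ (i + 1) ∣ x ^ p - 1 := by
    intro n hn
    induction n, hn using Nat.le_induction with
    | base => exact Or.inl (by simpa using hx)
    | succ n hn ih =>
      rcases ih with ih | ih
      swap
      · exact Or.inr ih
      rcases lt_or_ge i (powLevel p e n) with hlt | hge
      · exact Or.inr ((pow_dvd_pow π hlt).trans (h.pow_dvd_pow_sub_one hp ih))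
      · have hne : powLevel p e n ≠ i := fun heq => powLevel_notMem_freeLevels hp (heq ▸ hi)
        exact Or.inl (h.dvd_sub_one_of_pow hcl hp htors hn ih
          ((pow_dvd_pow π (lt_of_le_of_ne hge hne)).trans hxp))
  exact (key (i + 1) (Nat.le_add_left _ _)).elim
    (fun h' => h'.trans (sub_one_dvd_pow_sub_one x p)) id

section Characters

variable {p : ℕ} [Fact p.Prime]

lemma dvd_addChar_sub_one {χ : AddChar ℤ_[p] O} (hχ : Continuous χ) {d : O}
    (hd : d ∣ χ 1 - 1) (a : ℤ_[p]) : d ∣ χ a - 1 := by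
  refine PadicInt.denseRange_natCast.induction_on (p := fun a => d ∣ χ a - 1) a
    ((isClosed_setOf_dvd_sub d 1).preimage hχ) fun n => ?_
  rw [addChar_natCast]
  exact hd.trans (sub_one_dvd_pow_sub_one _ n)

variable {ι : Type*} [Fintype ι] {χ : ι → AddChar ℤ_[p] O}

lemma dvd_charProd_sub_one (hχ : ∀ i, Continuous (χ i)) {π : O} (h1 : ∀ i, π ∣ χ i 1 - 1)
    (a : ι → ℤ_[p]) : π ∣ charProd χ a - 1 := by
  rw [charProd_apply]
  exact Finset.prod_induction _ (fun x => π ∣ x - 1) (fun _ _ => dvd_mul_sub_one) (by simp)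
    fun i _ => dvd_addChar_sub_one (hχ i) (h1 i) _

end Characters

section Basis

variable {p e f : ℕ} [Fact p.Prime] {π : O} {c : Fin f → O}
  [Fintype (freeLevels p e)] {χ : freeLevels p e × Fin f → AddChar ℤ_[p] O}

variable [IsDomain O]

lemma charProd_surjective (h : IsMixedUniformizer p e π) (he : 0 < e)
    (hcl : ClosedContainsAdicLimits π)
    (htors : ∀ z : O, z ^ p = 1 → z = 1)
    (hspan : ∀ x : O, ∃ m : Fin f → ℕ, π ∣ x - ∑ j, (m j : O) * c j)
    (hχ : ∀ k, Continuous (χ k)) (hχ1 : ∀ i j, χ (i, j) 1 = 1 + c j * π ^ (i : ℕ))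
    {y : O} (hy : π ∣ y - 1) : ∃ a, charProd χ a = y := by
  have hp : p.Prime := Fact.out
  have key : ∀ n, 1 ≤ n → ∀ y, π ^ n ∣ y - 1 →
      ∃ x ∈ Set.range (charProd χ), π ^ n ∣ x - 1 ∧ π ^ (n + 1) ∣ y - x := by
    intro m
    induction m using Nat.strong_induction_on with
    | _ m ih =>
    intro hm y hy
    by_cases hI : m ∈ freeLevels p e
    · obtain ⟨t, ht⟩ := hy
      obtain ⟨b, hb⟩ := hspan t
      have hcongr := charProd_natCast_congr hχ1 ⟨m, hI⟩
        (fun k => if (k.1 : ℕ) = m then b k.2 else 0)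
        (fun i j hi => if_neg (ne_of_lt (show (i : ℕ) < m from hi)))
      simp only [if_true] at hcongr
      refine ⟨_, Set.mem_range_self _, dvd_sub_one_of_congr hcongr, ?_⟩
      rw [pow_succ] at hcongr ⊢
      convert dvd_sub (mul_dvd_mul_left (π ^ m) hb) hcongr using 1
      linear_combination ht
    · obtain ⟨n, hn, rfl⟩ := exists_powLevel_eq hp hm hI
      obtain ⟨x, hx, hyx⟩ := h.exists_pow_congr_of_injective hp hn
        (fun z hz hzp => h.dvd_sub_one_of_pow hcl hp htors hn hz hzp) hy
      obtain ⟨_, ⟨a, rfl⟩, ha, hxa⟩ := ih n (lt_powLevel hp he hn) hn x hx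
      have hu : IsUnit (charProd χ a) := h.isUnit _ ((dvd_pow_self π (by omega)).trans ha)
      obtain ⟨z, rfl⟩ := hu.dvd (a := x)
      have hz : π ^ (n + 1) ∣ z - 1 := by
        rw [← hu.dvd_mul_left, mul_sub, mul_one]; exact hxa
      have hzp : π ^ (powLevel p e n + 1) ∣ z ^ p - 1 :=
        (pow_dvd_pow π (powLevel_strictMono hp n.lt_succ_self)).trans (h.pow_dvd_pow_sub_one hp hz)
      refine ⟨charProd χ a ^ p, ⟨p • a, AddChar.map_nsmul_eq_pow _ _ _⟩,
        h.pow_dvd_pow_sub_one hp ha, ?_⟩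
      have : y - charProd χ a ^ p = (y - (charProd χ a * z) ^ p) +
          charProd χ a ^ p * (z ^ p - 1) := by ring
      rw [this]
      exact dvd_add hyx (hzp.mul_left _)
  refine mem_of_approximation hcl h.isUnit (isCompact_range (continuous_charProd hχ)).isClosed
    ⟨0, AddChar.map_zero_eq_one _⟩ ?_ le_rfl key (by simpa using hy)
  rintro _ ⟨a, rfl⟩ _ ⟨b, rfl⟩
  exact ⟨a + b, AddChar.map_add_eq_mul _ _ _⟩

lemma charProd_injective (h : IsMixedUniformizer p e π) (hcl : ClosedContainsAdicLimits π)
    (htors : ∀ z : O, z ^ p = 1 → z = 1)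
    (hind : ∀ m : Fin f → ℕ, π ∣ ∑ j, (m j : O) * c j → ∀ j, p ∣ m j)
    (hχ : ∀ k, Continuous (χ k)) (hχ1 : ∀ i j, χ (i, j) 1 = 1 + c j * π ^ (i : ℕ))
    {b : freeLevels p e × Fin f → ℤ_[p]} (hb : charProd χ b = 1) : b = 0 := by
  have hp : p.Prime := Fact.out
  have hχπ : ∀ k, π ∣ χ k 1 - 1 := fun ⟨i, j⟩ => by
    rw [hχ1, add_sub_cancel_left]
    exact (dvd_pow_self π (by have := i.2.1; omega)).mul_left _
  have step : ∀ b, charProd χ b = 1 → ∃ d, b = p • d ∧ charProd χ d = 1 := by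
    intro b hb
    have hdig : ∀ a : ℤ_[p], ∃ d, a = (a.zmodRepr : ℤ_[p]) + p * d := fun a => by
      have := PadicInt.sub_zmodRepr_mem a
      rw [PadicInt.maximalIdeal_eq_span_p, Ideal.mem_span_singleton] at this
      obtain ⟨d, hd⟩ := this
      exact ⟨d, by rw [← hd]; ring⟩
    choose d hd using fun k => hdig (b k)
    have hsplit : b = (fun k => ((b k).zmodRepr : ℤ_[p])) + p • d := by
      ext1 k
      rw [Pi.add_apply, Pi.smul_apply, nsmul_eq_mul]
      exact hd k
    have hprod : charProd χ (fun k => ((b k).zmodRepr : ℤ_[p])) * charProd χ d ^ p = 1 := by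
      rw [← AddChar.map_nsmul_eq_pow, ← AddChar.map_add_eq_mul, ← hsplit, hb]
    have hzero : ∀ k, (b k).zmodRepr = 0 := by
      by_contra! hne
      obtain ⟨⟨i₁, j₁⟩, h₁⟩ := hne
      obtain ⟨i₀, ⟨j₀, h₀⟩, hmin⟩ := WellFounded.has_min
        (wellFounded_lt : WellFounded (α := freeLevels p e) (· < ·))
        {i | ∃ j, (b (i, j)).zmodRepr ≠ 0} ⟨i₁, j₁, h₁⟩
      have hcongr := charProd_natCast_congr hχ1 i₀ (fun k => (b k).zmodRepr)
        (fun i j hi => by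
          by_contra hne
          exact hmin i ⟨j, hne⟩ hi)
      set P := charProd χ (fun k => ((b k).zmodRepr : ℤ_[p]))
      set γ := charProd χ d
      have hPu : IsUnit P := .of_mul_eq_one _ hprod
      have hP : π ^ (i₀ : ℕ) ∣ P - 1 := dvd_sub_one_of_congr hcongr
      have hγ : π ^ ((i₀ : ℕ) + 1) ∣ γ ^ p - 1 := by
        refine dvd_of_pow_dvd_pow_sub_one h hcl htors i₀.2 (dvd_charProd_sub_one hχ hχπ d) ?_
        rw [← hPu.dvd_mul_left, mul_sub, hprod, mul_one, ← dvd_neg, neg_sub]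
        exact hP
      have hP' : π ^ ((i₀ : ℕ) + 1) ∣ P - 1 := by
        have : P - 1 = -(P * (γ ^ p - 1)) := by linear_combination hprod
        rw [this, dvd_neg]
        exact hγ.mul_left _
      have h2 := dvd_sub hP' hcongr
      rw [show P - 1 - (P - (1 + π ^ (i₀ : ℕ) * ∑ j, ((b (i₀, j)).zmodRepr : O) * c j)) =
        π ^ (i₀ : ℕ) * ∑ j, ((b (i₀, j)).zmodRepr : O) * c j by ring, pow_succ,
        mul_dvd_mul_iff_left (pow_ne_zero _ h.prime.ne_zero)] at h2
      exact h₀ (Nat.eq_zero_of_dvd_of_lt (hind _ h2 j₀) (PadicInt.zmodRepr_lt_p _))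
    have hfun : (fun k => ((b k).zmodRepr : ℤ_[p])) = 0 := by
      ext1 k
      simp [hzero k]
    rw [hfun, AddChar.map_zero_eq_one, one_mul] at hprod
    rw [hfun, zero_add] at hsplit
    exact ⟨d, hsplit, htors _ hprod⟩
  have hpow : ∀ n : ℕ, ∀ b, charProd χ b = 1 → ∀ k, (p : ℤ_[p]) ^ n ∣ b k := by
    intro n
    induction n with
    | zero => simp
    | succ n ih =>
      intro b hb k
      obtain ⟨d, rfl, hd⟩ := step b hb
      rw [Pi.smul_apply, nsmul_eq_mul, pow_succ']
      exact mul_dvd_mul_left _ (ih d hd k)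
  ext1 k
  by_contra hk
  obtain ⟨n, hn⟩ := FiniteMultiplicity.of_prime_left PadicInt.prime_p hk
  exact hn (hpow _ b hb k)

end Basis

end Topology

section AddValuation

variable {K : Type*} [Field K]

/-- The valuation ring of an additive valuation. -/
def integerSubring (v : AddValuation K (WithTop ℤ)) : Subring K where
  carrier := {x | 0 ≤ v x}
  mul_mem' {a b} ha hb := by
    simp only [Set.mem_ofPred_eq, v.map_mul] at *
    exact add_nonneg ha hb
  one_mem' := by simp
  add_mem' ha hb := v.map_le_add ha hb
  zero_mem' := by simp
  neg_mem' ha := by simpa using ha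

variable {v : AddValuation K (WithTop ℤ)}

lemma integerSubring_dvd_iff {x y : integerSubring v} (hx : x ≠ 0) :
    x ∣ y ↔ v (x : K) ≤ v (y : K) := by
  have hx' : (x : K) ≠ 0 := by simpa using hx
  constructor
  · rintro ⟨z, rfl⟩
    rw [Subring.coe_mul, v.map_mul]
    exact le_add_of_nonneg_right z.2
  · intro h
    have hval : v ((y : K) / x) + v (x : K) = v (y : K) := by
      rw [← v.map_mul, div_mul_cancel₀ _ hx']
    have hnn : 0 ≤ v ((y : K) / x) := by
      have hxt : v (x : K) ≠ ⊤ := v.ne_top_iff.2 hx'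
      by_contra! hneg
      have := WithTop.add_lt_add_right hxt hneg
      rw [hval, zero_add] at this
      exact absurd h this.not_ge
    exact ⟨⟨_, hnn⟩, Subtype.ext (mul_div_cancel₀ _ hx').symm⟩

lemma map_pow_of_eq_one {π : K} (hπ : v π = ((1 : ℤ) : WithTop ℤ)) (n : ℕ) :
    v (π ^ n) = ((n : ℤ) : WithTop ℤ) := by
  rw [v.map_pow, hπ, ← WithTop.coe_nsmul]
  simp

lemma uniformizer_pow_dvd_iff {π x : integerSubring v} (hπ : v (π : K) = ((1 : ℤ) : WithTop ℤ))
    {n : ℕ} : π ^ n ∣ x ↔ ((n : ℤ) : WithTop ℤ) ≤ v (x : K) := by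
  have h0 : π ≠ 0 := by
    rintro rfl
    simp at hπ
  rw [integerSubring_dvd_iff (pow_ne_zero n h0), Subring.coe_pow, map_pow_of_eq_one hπ]

lemma uniformizer_dvd_iff {π x : integerSubring v} (hπ : v (π : K) = ((1 : ℤ) : WithTop ℤ)) :
    π ∣ x ↔ ((1 : ℤ) : WithTop ℤ) ≤ v (x : K) := by
  simpa using uniformizer_pow_dvd_iff (n := 1) hπ

lemma uniformizer_not_dvd_iff {π x : integerSubring v} (hπ : v (π : K) = ((1 : ℤ) : WithTop ℤ)) :
    ¬π ∣ x ↔ v (x : K) = 0 := by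
  rw [uniformizer_dvd_iff hπ, not_le]
  have := x.2
  change 0 ≤ v (x : K) at this
  generalize v (x : K) = a at *
  induction a with
  | top => simp
  | coe a =>
    norm_cast at *
    omega

lemma isUnit_integerSubring_iff {x : integerSubring v} : IsUnit x ↔ v (x : K) = 0 := by
  by_cases hx : x = 0
  · simp [hx]
  rw [isUnit_iff_dvd_one, integerSubring_dvd_iff hx, Subring.coe_one, v.map_one]
  exact ⟨fun h => le_antisymm h x.2, fun h => h.le⟩

lemma prime_uniformizer {π : integerSubring v} (hπ : v (π : K) = ((1 : ℤ) : WithTop ℤ)) :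
    Prime π := by
  refine ⟨?_, ?_, fun a b h => ?_⟩
  · rintro rfl
    simp at hπ
  · rw [isUnit_integerSubring_iff, hπ]
    norm_cast
  · by_contra! hab
    rw [uniformizer_not_dvd_iff hπ, uniformizer_not_dvd_iff hπ] at hab
    refine (uniformizer_not_dvd_iff hπ).2 ?_ h
    rw [Subring.coe_mul, v.map_mul, hab.1, hab.2, add_zero]

section ResidueBasis

variable {p f : ℕ} {π : integerSubring v} {c : Fin f → integerSubring v}

lemma IsResidueBasis.dvd_of_dvd_sum (hπ : v (π : K) = ((1 : ℤ) : WithTop ℤ))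
    (hc : IsResidueBasis p v fun j => (c j : K)) (m : Fin f → ℕ)
    (hm : π ∣ ∑ j, (m j : integerSubring v) * c j) (j : Fin f) : p ∣ m j := by
  rw [uniformizer_dvd_iff hπ] at hm
  have := hc.2.1 (fun j => (m j : ℤ)) (by simpa using hm) j
  exact_mod_cast this

lemma IsResidueBasis.exists_dvd_sub_sum (hπ : v (π : K) = ((1 : ℤ) : WithTop ℤ))
    (hp : 0 < p) (hpπ : π ∣ p) (hc : IsResidueBasis p v fun j => (c j : K))
    (x : integerSubring v) : ∃ m : Fin f → ℕ, (∀ j, m j < p) ∧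
      π ∣ x - ∑ j, (m j : integerSubring v) * c j := by
  obtain ⟨a, ha⟩ := hc.2.2 x x.2
  have ha' : π ∣ x - ∑ j, (a j : integerSubring v) * c j := by
    rw [uniformizer_dvd_iff hπ]
    simpa using ha
  have hp' : (0 : ℤ) < p := by exact_mod_cast hp
  have hm : ∀ j, (((a j % p).toNat : ℕ) : ℤ) = a j % p := fun j =>
    Int.toNat_of_nonneg (Int.emod_nonneg _ hp'.ne')
  refine ⟨fun j => (a j % p).toNat, fun j => ?_, ?_⟩
  · have := Int.emod_lt_of_pos (a j) hp'
    rw [← hm] at this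
    exact_mod_cast this
  · have hj : ∀ j, (((a j % p).toNat : ℕ) : integerSubring v) = a j - p * (a j / p : ℤ) := by
      intro j
      rw [← Int.cast_natCast, hm, Int.emod_def]
      push_cast
      rfl
    have : x - ∑ j, (((a j % p).toNat : ℕ) : integerSubring v) * c j =
        (x - ∑ j, (a j : integerSubring v) * c j) + p * ∑ j, ((a j / p : ℤ) : integerSubring v) *
          c j := by
      simp only [hj, sub_mul, Finset.sum_sub_distrib, Finset.mul_sum, mul_assoc]
      ring
    rw [this]
    exact dvd_add ha' (hpπ.mul_right _)

lemma IsResidueBasis.finite_quotient (hπ : v (π : K) = ((1 : ℤ) : WithTop ℤ))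
    (hp : 0 < p) (hpπ : π ∣ p) (hc : IsResidueBasis p v fun j => (c j : K)) :
    Finite (integerSubring v ⧸ Ideal.span {π}) := by
  refine Finite.of_surjective (fun m : Fin f → Fin p =>
    Ideal.Quotient.mk (Ideal.span {π}) (∑ j, ((m j : ℕ) : integerSubring v) * c j)) fun x => ?_
  obtain ⟨x, rfl⟩ := Ideal.Quotient.mk_surjective x
  obtain ⟨m, hm, hx⟩ := hc.exists_dvd_sub_sum hπ hp hpπ x
  refine ⟨fun j => ⟨m j, hm j⟩, ?_⟩
  rw [eq_comm, Ideal.Quotient.eq, Ideal.mem_span_singleton]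
  exact hx

lemma isMixedUniformizer [Fact p.Prime] [Algebra ℚ_[p] K] {e : ℕ} (hv : IsPadicValuation p v e)
    (hπ : v (π : K) = ((1 : ℤ) : WithTop ℤ)) (hc : IsResidueBasis p v fun j => (c j : K)) :
    IsMixedUniformizer p e π := by
  have hp : p.Prime := Fact.out
  have hvp : v (p : K) = ((e : ℤ) : WithTop ℤ) := by
    have := hv.2.2 (p : ℚ_[p]) (by exact_mod_cast hp.ne_zero)
    simpa using this
  obtain ⟨u, hu⟩ : π ^ e ∣ (p : integerSubring v) := by
    rw [uniformizer_pow_dvd_iff hπ]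
    simp [hvp]
  have hpπ : π ∣ (p : integerSubring v) :=
    (dvd_pow_self π hv.2.1.ne').trans ⟨u, hu⟩
  refine ⟨prime_uniformizer hπ, ⟨u, hu, fun hpu => ?_⟩, fun x hx => ?_,
    hc.finite_quotient hπ hp.pos hpπ⟩
  · have h1 : π ^ (e + 1) ∣ (p : integerSubring v) := by
      rw [hu, pow_succ]
      exact mul_dvd_mul_left _ hpu
    rw [uniformizer_pow_dvd_iff hπ, Subring.coe_natCast, hvp] at h1
    norm_cast at h1
    omega
  · rw [isUnit_integerSubring_iff, ← uniformizer_not_dvd_iff hπ]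
    exact not_dvd_of_dvd_sub_one (prime_uniformizer hπ) hx

end ResidueBasis

section Norm

/-- The real number `ρ ^ n`, with `ρ ^ ∞ = 0`. -/
def expWithTop (ρ : ℝ) : WithTop ℤ → ℝ
  | ⊤ => 0
  | (n : ℤ) => ρ ^ n

@[simp]
lemma expWithTop_top (ρ : ℝ) : expWithTop ρ ⊤ = 0 := rfl

@[simp]
lemma expWithTop_coe (ρ : ℝ) (n : ℤ) : expWithTop ρ n = ρ ^ n := rfl

variable {ρ : ℝ}

lemma expWithTop_add (h0 : 0 < ρ) (a b : WithTop ℤ) :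
    expWithTop ρ (a + b) = expWithTop ρ a * expWithTop ρ b := by
  induction a with
  | top => simp
  | coe a =>
    induction b with
    | top => simp
    | coe b =>
      rw [← WithTop.coe_add, expWithTop_coe, expWithTop_coe, expWithTop_coe, zpow_add₀ h0.ne']

lemma expWithTop_nonneg (h0 : 0 < ρ) (a : WithTop ℤ) : 0 ≤ expWithTop ρ a := by
  induction a with
  | top => simp
  | coe a => exact (zpow_pos h0 a).le

lemma expWithTop_eq_zero_iff (h0 : 0 < ρ) {a : WithTop ℤ} : expWithTop ρ a = 0 ↔ a = ⊤ := by
  induction a with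
  | top => simp
  | coe a => simpa using (zpow_pos h0 a).ne'

lemma expWithTop_le_iff (h0 : 0 < ρ) (h1 : ρ < 1) {a b : WithTop ℤ} :
    expWithTop ρ a ≤ expWithTop ρ b ↔ b ≤ a := by
  induction a with
  | top => simp [expWithTop_nonneg h0]
  | coe a =>
    induction b with
    | top => simpa using zpow_pos h0 a
    | coe b => simp [zpow_le_zpow_iff_right_of_lt_one₀ h0 h1]

lemma expWithTop_map_add_le (h0 : 0 < ρ) (h1 : ρ < 1) (x y : K) :
    expWithTop ρ (v (x + y)) ≤ max (expWithTop ρ (v x)) (expWithTop ρ (v y)) := by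
  rw [le_max_iff, expWithTop_le_iff h0 h1, expWithTop_le_iff h0 h1, ← min_le_iff]
  exact v.map_add x y

end Norm

/-- The absolute value `ρ ^ v(x)` attached to an additive valuation `v`. -/
def absoluteValueOfAddValuation (v : AddValuation K (WithTop ℤ)) {ρ : ℝ} (h0 : 0 < ρ)
    (h1 : ρ < 1) : AbsoluteValue K ℝ where
  toFun x := expWithTop ρ (v x)
  map_mul' x y := by rw [v.map_mul, expWithTop_add h0]
  nonneg' x := expWithTop_nonneg h0 _
  eq_zero' x := by rw [expWithTop_eq_zero_iff h0, v.top_iff]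
  add_le' x y := (expWithTop_map_add_le h0 h1 x y).trans
    (max_le_add_of_nonneg (expWithTop_nonneg h0 _) (expWithTop_nonneg h0 _))

end AddValuation

section NormedField

lemma compactSpace_integerSubring (p : ℕ) [Fact p.Prime] {K : Type*} [NormedField K]
    [NormedAlgebra ℚ_[p] K] [FiniteDimensional ℚ_[p] K] {v : AddValuation K (WithTop ℤ)}
    (hnorm : ∀ x : K, ‖x‖ ≤ 1 ↔ 0 ≤ v x) : CompactSpace (integerSubring v) := by
  have : ProperSpace K := FiniteDimensional.proper ℚ_[p] K
  refine isCompact_iff_compactSpace.1 ?_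
  convert isCompact_closedBall (0 : K) 1
  ext x
  rw [mem_closedBall_zero_iff, hnorm]
  rfl

lemma closedContainsAdicLimits_integerSubring {K : Type*} [NormedField K]
    {v : AddValuation K (WithTop ℤ)} (hnorm : ∀ x : K, ‖x‖ ≤ 1 ↔ 0 ≤ v x)
    {π : integerSubring v} (hπ : ‖(π : K)‖ < 1) : ClosedContainsAdicLimits π := by
  intro S hS y hy
  rw [← hS.closure_eq, Metric.mem_closure_iff]
  intro ε hε
  obtain ⟨n, hn⟩ := exists_pow_lt_of_lt_one hε hπ
  obtain ⟨h, hhS, z, hz⟩ := hy n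
  refine ⟨h, hhS, lt_of_le_of_lt ?_ hn⟩
  rw [Subtype.dist_eq, dist_eq_norm, ← AddSubgroupClass.coe_sub, hz, Subring.coe_mul, Subring.coe_pow,
    norm_mul, norm_pow]
  exact mul_le_of_le_one_right (by positivity) ((hnorm _).2 z.2)

variable {p : ℕ} [Fact p.Prime] {K : Type*} [NormedField K] [NormedAlgebra ℚ_[p] K]
  [FiniteDimensional ℚ_[p] K] {v : AddValuation K (WithTop ℤ)}

variable [IsUltrametricDist K]

lemma exists_addChar_integerSubring (hnorm : ∀ x : K, ‖x‖ ≤ 1 ↔ 0 ≤ v x)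
    {r : integerSubring v} (hr : ‖(r : K)‖ < 1) :
    ∃ χ : AddChar ℤ_[p] (integerSubring v), Continuous χ ∧ χ 1 = 1 + r := by
  have : CompleteSpace K := FiniteDimensional.complete ℚ_[p] K
  let _ : Algebra ℤ_[p] K := ((algebraMap ℚ_[p] K).comp (algebraMap ℤ_[p] ℚ_[p])).toAlgebra
  have : IsBoundedSMul ℤ_[p] K := IsBoundedSMul.of_norm_smul_le fun a x => by
    rw [Algebra.smul_def, norm_mul]
    refine mul_le_mul_of_nonneg_right (le_of_eq ?_) (norm_nonneg x)
    exact norm_algebraMap' K (a : ℚ_[p])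
  have ht := tendsto_pow_atTop_nhds_zero_iff_norm_lt_one.2 hr
  set κ := PadicInt.addChar_of_value_at_one (p := p) (r : K) ht
  have hκ : Continuous κ := PadicInt.continuous_addChar_of_value_at_one ht
  have hκ1 : κ 1 = 1 + r := PadicInt.addChar_of_value_at_one_def ht
  have hmem : ∀ a, κ a ∈ integerSubring v := fun a => by
    refine PadicInt.denseRange_natCast.induction_on (p := fun a => κ a ∈ integerSubring v) a ?_
      fun n => ?_
    · have : {a | κ a ∈ integerSubring v} = {a | ‖κ a‖ ≤ 1} := by
        ext a
        exact (hnorm _).symm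
      rw [this]
      exact isClosed_le hκ.norm continuous_const
    · rw [addChar_natCast, hκ1]
      exact pow_mem (add_mem (one_mem _) r.2) n
  refine ⟨⟨fun a => ⟨κ a, hmem a⟩, Subtype.ext (AddChar.map_zero_eq_one κ),
    fun a b => Subtype.ext (AddChar.map_add_eq_mul κ a b)⟩, hκ.subtype_mk _, Subtype.ext hκ1⟩

theorem exists_mulEquiv_principalUnits {e f : ℕ} (hv : IsPadicValuation p v e)
    (hnorm : ∀ x : K, ‖x‖ ≤ 1 ↔ 0 ≤ v x) (hζ : ¬∃ ζ : K, IsPrimitiveRoot ζ p)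
    {π : K} (hπ : v π = ((1 : ℤ) : WithTop ℤ)) (hπ1 : ‖π‖ < 1)
    {c : Fin f → K} (hc : IsResidueBasis p v c) :
    ∃ Φ : Multiplicative ((freeLevels p e × Fin f) → ℤ_[p]) ≃* principalUnits v 0,
      ∀ (i : freeLevels p e) (j : Fin f),
        ((Φ (Multiplicative.ofAdd (Pi.single (i, j) 1)) : Kˣ) : K) = 1 + c j * π ^ (i : ℕ) := by
  have hp : p.Prime := Fact.out
  have := compactSpace_integerSubring p hnorm
  have : Fintype (freeLevels p e) := (freeLevels_finite hp).fintype
  lift π to integerSubring v using (show 0 ≤ v π by rw [hπ]; norm_cast)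
  lift c to Fin f → integerSubring v using hc.1
  have hU := isMixedUniformizer hv hπ hc
  have hcl := closedContainsAdicLimits_integerSubring hnorm hπ1
  have htors : ∀ z : integerSubring v, z ^ p = 1 → z = 1 := by
    intro z hz
    by_contra hne
    refine hζ ⟨z, ?_⟩
    rw [← orderOf_eq_prime (x := (z : K)) (p := p) (by exact_mod_cast congrArg Subtype.val hz)
      (by simpa using hne)]
    exact IsPrimitiveRoot.orderOf _
  have hχ : ∀ k : freeLevels p e × Fin f, ∃ χ : AddChar ℤ_[p] (integerSubring v),
      Continuous χ ∧ χ 1 = 1 + c k.2 * π ^ (k.1 : ℕ) := by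
    intro k
    refine exists_addChar_integerSubring hnorm ?_
    rw [Subring.coe_mul, Subring.coe_pow, norm_mul, norm_pow]
    refine mul_lt_one_of_nonneg_of_lt_one_right ((hnorm _).2 (c k.2).2) (by positivity) ?_
    exact pow_lt_one₀ (norm_nonneg _) hπ1 (Nat.one_le_iff_ne_zero.1 k.1.2.1)
  choose χ hχc hχ1 using hχ
  have hχ1' : ∀ i j, χ (i, j) 1 = 1 + c j * π ^ (i : ℕ) := fun i j => hχ1 (i, j)
  have hmem : ∀ u : Kˣ, u ∈ principalUnits v 0 ↔ ((1 : ℤ) : WithTop ℤ) ≤ v ((u : K) - 1) :=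
    fun u => Iff.rfl
  let F : Multiplicative ((freeLevels p e × Fin f) → ℤ_[p]) →* Kˣ :=
    ((integerSubring v).subtype.toMonoidHom.comp (charProd χ).toMonoidHom).toHomUnits
  have hF : ∀ a, (F a : K) = charProd χ a.toAdd := fun a => rfl
  have hFmem : ∀ a, F a ∈ principalUnits v 0 := by
    intro a
    rw [hmem, hF]
    refine (uniformizer_dvd_iff hπ).1 (dvd_charProd_sub_one hχc (fun k => ?_) a.toAdd)
    rw [hχ1, add_sub_cancel_left]
    exact (dvd_pow_self π (Nat.one_le_iff_ne_zero.1 k.1.2.1)).mul_left _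
  refine ⟨MulEquiv.ofBijective (F.codRestrict _ hFmem) ⟨?_, ?_⟩, fun i j => ?_⟩
  · rw [injective_iff_map_eq_one]
    intro a ha
    have ha' : charProd χ a.toAdd = 1 :=
      Subtype.ext (congrArg (fun u : principalUnits v 0 => ((u : Kˣ) : K)) ha)
    exact charProd_injective hU hcl htors (hc.dvd_of_dvd_sum hπ) hχc hχ1' ha'
  · rintro ⟨u, hu⟩
    rw [hmem] at hu
    have hu0 : (u : K) ∈ integerSubring v := by
      have : (u : K) = (u - 1) + 1 := by ring
      rw [this]
      exact add_mem ((show (0 : WithTop ℤ) ≤ ((1 : ℤ) : WithTop ℤ) by norm_cast).trans hu)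
        (one_mem _)
    have hpπ : π ∣ (p : integerSubring v) := by
      obtain ⟨w, hw, -⟩ := hU.exists_eq
      exact (dvd_pow_self π hv.2.1.ne').trans ⟨w, hw⟩
    obtain ⟨a, ha⟩ := charProd_surjective hU hv.2.1 hcl htors
      (fun x => (hc.exists_dvd_sub_sum hπ hp.pos hpπ x).imp fun _ h => h.2) hχc hχ1'
      (y := ⟨u, hu0⟩) ((uniformizer_dvd_iff hπ).2 hu)
    exact ⟨Multiplicative.ofAdd a, Subtype.ext (Units.ext (congrArg Subtype.val ha))⟩
  · change ((charProd χ (Pi.single (i, j) 1) : integerSubring v) : K) = _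
    rw [charProd_single, hχ1]
    push_cast
    rfl

end NormedField

/-- Fesenko–Vostokov. Assume `ζ_p ∉ K`. Then `U_K^1` is a free
`ℤ_p`-module of rank `n_K = [K : ℚ_p]`, with basis the elements `η_{(i,j)} = 1 + c_j π^i`
for `i ∈ I`, `1 ≤ j ≤ f_K`: there is a group isomorphism
`ℤ_p^{I × f_K} ≃ U_K^1` sending the `(i,j)`-th standard generator to `1 + c_j π^i`
(so every `α ∈ U_K^1` is uniquely `∏_{i,j} (1 + c_j π^i)^{a_{ij}}` with `a_{ij} ∈ ℤ_p`). -/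
theorem statement_19
    (p : ℕ) [Fact p.Prime]
    (K : Type*) [Field K] [Algebra ℚ_[p] K] [FiniteDimensional ℚ_[p] K]
    (vK : AddValuation K (WithTop ℤ)) (eK fK : ℕ)
    (hvK : IsPadicValuation p vK eK)
    (hfK : eK * fK = Module.finrank ℚ_[p] K)
    (hζ : ¬∃ ζ : K, IsPrimitiveRoot ζ p)
    (π : K) (hπ : vK π = ((1 : ℤ) : WithTop ℤ))
    (c : Fin fK → K) (hc : IsResidueBasis p vK c) :
    Nat.card {i : ℕ | 1 ≤ i ∧ (p - 1) * i < p * eK ∧ Nat.Coprime i p} * fK =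
      Module.finrank ℚ_[p] K ∧
    ∃ Φ : Multiplicative
        ((↥{i : ℕ | 1 ≤ i ∧ (p - 1) * i < p * eK ∧ Nat.Coprime i p} × Fin fK) → ℤ_[p]) ≃*
        ↥(principalUnits vK 0),
      ∀ (i : ↥{i : ℕ | 1 ≤ i ∧ (p - 1) * i < p * eK ∧ Nat.Coprime i p}) (j : Fin fK),
        ((Φ (Multiplicative.ofAdd (Pi.single (i, j) 1)) : Kˣ) : K) =
          1 + c j * π ^ (i : ℕ) := by
  have hp : p.Prime := Fact.out
  refine ⟨by rw [← hfK]; exact congrArg (· * fK) (card_freeLevels hp), ?_⟩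
  have hp0 : (0 : ℝ) < p := by exact_mod_cast hp.pos
  have he : (0 : ℝ) < eK := by exact_mod_cast hvK.2.1
  set ρ : ℝ := (p : ℝ) ^ (-(eK : ℝ)⁻¹) with hρ
  have h0 : 0 < ρ := Real.rpow_pos_of_pos hp0 _
  have h1 : ρ < 1 := Real.rpow_lt_one_of_one_lt_of_neg (by exact_mod_cast hp.one_lt)
    (neg_neg_of_pos (inv_pos.2 he))
  have hρe : ρ ^ (eK : ℤ) = (p : ℝ)⁻¹ := by
    rw [hρ, zpow_natCast, ← Real.rpow_natCast, ← Real.rpow_mul hp0.le, neg_mul,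
      inv_mul_cancel₀ he.ne', Real.rpow_neg_one]
  let _ : NormedField K := (absoluteValueOfAddValuation vK h0 h1).toNormedField
  have hnorm : ∀ x : K, ‖x‖ = expWithTop ρ (vK x) := fun x => rfl
  let _ : NormedAlgebra ℚ_[p] K :=
    { ‹Algebra ℚ_[p] K› with
      norm_smul_le := fun r x => by
        rw [Algebra.smul_def, norm_mul]
        refine mul_le_mul_of_nonneg_right (le_of_eq ?_) (norm_nonneg x)
        by_cases hr : r = 0
        · simp [hr]
        · rw [hnorm, hvK.2.2 r hr, expWithTop_coe, zpow_mul, hρe,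
            Padic.norm_eq_zpow_neg_valuation hr, inv_zpow, zpow_neg] }
  have : IsUltrametricDist K := IsUltrametricDist.isUltrametricDist_of_forall_norm_add_le_max_norm
    fun x y => expWithTop_map_add_le h0 h1 x y
  have hnorm1 : ∀ x : K, ‖x‖ ≤ 1 ↔ 0 ≤ vK x := fun x => by
    have h00 : expWithTop ρ 0 = 1 := zpow_zero ρ
    rw [hnorm, ← expWithTop_le_iff h0 h1, h00]
  exact exists_mulEquiv_principalUnits hvK hnorm1 hζ hπ
    (by rwa [hnorm, hπ, expWithTop_coe, zpow_one]) hc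

end PaperRam
end
end
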